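/- arXiv:1003.4713 — 4 statements merged into one kernel-verified Lean document; each statement's English description precedes it below -/
import Mathlib

section
/- Decay of the pseudoconformal remainder: let φ be a rapidly decaying smooth solution of the Hartree equation with v(x) = χ(|x|)/|x|, where χ : [0,∞) → [0,∞) is smooth, compactly supported, and nonincreasing. Then there exists a constant C (depending on φ and v) such that |R_c(t)| ≤ C t^{−1/2} for all t ≥ 1. -/
open MeasureTheory

noncomputable section

/-- Three-dimensional Euclidean space. -/
abbrev E3 : Type := EuclideanSpace ℝ (Fin 3)

/-- Spatial Laplacian of a complex-valued function on `ℝ³`. -/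
def lapC (f : E3 → ℂ) (x : E3) : ℂ :=
  ∑ j : Fin 3, fderiv ℝ (fun y => fderiv ℝ f y (EuclideanSpace.single j 1)) x
    (EuclideanSpace.single j 1)

/-- Spatial Laplacian of a real-valued function on `ℝ³`. -/
def lapR (f : E3 → ℝ) (x : E3) : ℝ :=
  ∑ j : Fin 3, fderiv ℝ (fun y => fderiv ℝ f y (EuclideanSpace.single j 1)) x
    (EuclideanSpace.single j 1)

/-- The Hartree self-interaction potential `W = v * |f|²` (convolution on `ℝ³`). -/
def hartreeW (v : E3 → ℝ) (f : E3 → ℂ) (x : E3) : ℝ :=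
  MeasureTheory.convolution v (fun y => ‖f y‖ ^ 2) (ContinuousLinearMap.lsmul ℝ ℝ) volume x

/-- A rapidly decaying smooth solution of the Hartree equation
`i ∂ₜ φ + Δφ − (v * |φ|²) φ = 0`:  `φ` is smooth on space-time, every spatial
Schwartz-type seminorm of every space-time derivative of `φ` is bounded on compact
time intervals, and the equation holds pointwise. -/
structure IsHartreeSolution (v : E3 → ℝ) (φ : ℝ → E3 → ℂ) : Prop where
  smooth : ContDiff ℝ (⊤ : ℕ∞) (fun p : ℝ × E3 => φ p.1 p.2)
  decay : ∀ (k n : ℕ) (T : ℝ), ∃ C : ℝ, ∀ (t : ℝ) (x : E3), |t| ≤ T →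
    ‖x‖ ^ k * ‖iteratedFDeriv ℝ n (fun p : ℝ × E3 => φ p.1 p.2) (t, x)‖ ≤ C
  eqn : ∀ (t : ℝ) (x : E3),
    Complex.I * deriv (fun s => φ s x) t + lapC (φ t) x
      - (hartreeW v (φ t) x : ℂ) * φ t x = 0

/-- Mass density `ρ = ½|φ|²`. -/
def rhoH (φ : ℝ → E3 → ℂ) (t : ℝ) (x : E3) : ℝ := (1 / 2 : ℝ) * ‖φ t x‖ ^ 2

/-- The pseudoconformally rescaled profile `ψ_t(x) = e^{i|x|²/(4t)} φ(t,x)`. -/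
def psiH (φ : ℝ → E3 → ℂ) (t : ℝ) (x : E3) : ℂ :=
  Complex.exp (Complex.I * ((‖x‖ ^ 2 : ℝ) / (4 * t))) * φ t x

/-- The pseudoconformal energy
`E_c(t) = t² ∫ ( |∇ψ_t|² + W ρ ) dx`. -/
def EcH (v : E3 → ℝ) (φ : ℝ → E3 → ℂ) (t : ℝ) : ℝ :=
  t ^ 2 * ∫ x : E3,
    ((∑ j : Fin 3, ‖fderiv ℝ (psiH φ t) x (EuclideanSpace.single j 1)‖ ^ 2)
      + hartreeW v (φ t) x * rhoH φ t x)

/-- The pseudoconformal remainder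
`R_c(t) = t ∫∫ ( −4V(|x−y|) − 2|x−y| V′(|x−y|) ) ρ(t,x) ρ(t,y) dx dy`. -/
def RcH (V : ℝ → ℝ) (φ : ℝ → E3 → ℂ) (t : ℝ) : ℝ :=
  t * ∫ x : E3, ∫ y : E3,
    (-4 * V ‖x - y‖ - 2 * ‖x - y‖ * deriv V ‖x - y‖) * rhoH φ t x * rhoH φ t y

/-- The remainder for the rescaled pseudoconformal energy:
`R_cc(t) = ∫ |∇ψ_t|² dx − 2 ∫∫ ( V(|x−y|) + |x−y| V′(|x−y|) ) ρ(t,x) ρ(t,y) dx dy`. -/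
def RccH (V : ℝ → ℝ) (φ : ℝ → E3 → ℂ) (t : ℝ) : ℝ :=
  (∫ x : E3, ∑ j : Fin 3, ‖fderiv ℝ (psiH φ t) x (EuclideanSpace.single j 1)‖ ^ 2)
    - 2 * ∫ x : E3, ∫ y : E3,
        (V ‖x - y‖ + ‖x - y‖ * deriv V ‖x - y‖) * rhoH φ t x * rhoH φ t y

/-- The hypotheses on the cut-off `χ` in the Coulomb-type potential `v(x) = χ(|x|)/|x|`:
`χ` is smooth, nonnegative, compactly supported and nonincreasing on `[0,∞)`. -/
structure IsCutoff (χ : ℝ → ℝ) : Prop where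
  smooth : ContDiff ℝ (⊤ : ℕ∞) χ
  nonneg : ∀ r, 0 ≤ χ r
  compact_supp : HasCompactSupport χ
  mono : AntitoneOn χ (Set.Ici 0)

/-- An integrable weight on `ℝ³`. -/
def decayWeight (x : E3) : ℝ := (1 + ‖x‖) ^ (-4 : ℝ)

lemma decayWeight_pos (x : E3) : 0 < decayWeight x := by unfold decayWeight; positivity

lemma decayWeight_le_one (x : E3) : decayWeight x ≤ 1 :=
  Real.rpow_le_one_of_one_le_of_nonpos (by linarith [norm_nonneg x]) (by norm_num)

lemma continuous_decayWeight : Continuous decayWeight :=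
  (continuous_const.add continuous_norm).rpow_const
    fun x => Or.inl (by positivity : (1 + ‖x‖ : ℝ) ≠ 0)

lemma integrable_decayWeight : Integrable decayWeight :=
  integrable_one_add_norm (by norm_num)

lemma le_mul_decayWeight {C₀ C₄ y : ℝ} (x : E3) (hy : 0 ≤ y) (h₀ : y ≤ C₀) (h₄ : ‖x‖ ^ 4 * y ≤ C₄) :
    y ≤ (8 * (C₀ + C₄)) * decayWeight x := by
  have h1 : decayWeight x = ((1 + ‖x‖) ^ 4)⁻¹ := by
    unfold decayWeight
    rw [Real.rpow_neg (by positivity)]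
    norm_cast
  rw [h1, ← div_eq_mul_inv, le_div_iff₀ (by positivity)]
  have h2 : (1 + ‖x‖) ^ 4 ≤ 8 * (1 + ‖x‖ ^ 4) := by
    nlinarith [sq_nonneg (‖x‖ - 1), sq_nonneg (‖x‖ ^ 2 - 1), sq_nonneg (‖x‖ ^ 2 - ‖x‖)]
  nlinarith [mul_le_mul_of_nonneg_left h2 hy]

/-- Continuous functions on space-time that decay rapidly in space, locally uniformly in time. -/
structure LocDecay (f : ℝ × E3 → ℝ) : Prop where
  cont : Continuous f
  decay : ∀ (k : ℕ) (T : ℝ), ∃ C : ℝ, ∀ (t : ℝ) (x : E3), |t| ≤ T → ‖x‖ ^ k * |f (t, x)| ≤ C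

namespace LocDecay

variable {f g : ℝ × E3 → ℝ}

lemma add (hf : LocDecay f) (hg : LocDecay g) : LocDecay fun p => f p + g p := by
  refine ⟨hf.cont.add hg.cont, fun k T => ?_⟩
  obtain ⟨C, hC⟩ := hf.decay k T
  obtain ⟨D, hD⟩ := hg.decay k T
  refine ⟨C + D, fun t x ht => ?_⟩
  have h : ‖x‖ ^ k * |f (t, x) + g (t, x)| ≤ ‖x‖ ^ k * (|f (t, x)| + |g (t, x)|) := by
    gcongr; exact abs_add_le _ _
  linarith [hC t x ht, hD t x ht]

lemma const_mul (c : ℝ) (hf : LocDecay f) : LocDecay fun p => c * f p := by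
  refine ⟨hf.cont.const_mul c, fun k T => ?_⟩
  obtain ⟨C, hC⟩ := hf.decay k T
  refine ⟨|c| * C, fun t x ht => ?_⟩
  rw [abs_mul, mul_left_comm]
  gcongr
  exact hC t x ht

lemma neg (hf : LocDecay f) : LocDecay fun p => -f p := by
  simpa using hf.const_mul (-1)

lemma sub (hf : LocDecay f) (hg : LocDecay g) : LocDecay fun p => f p - g p := by
  simpa [sub_eq_add_neg] using hf.add hg.neg

lemma abs_coord_le (x : E3) (j : Fin 3) : |x j| ≤ ‖x‖ := by
  simpa using PiLp.norm_apply_le x j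

lemma coord_mul (j : Fin 3) (hf : LocDecay f) : LocDecay fun p => p.2 j * f p := by
  refine ⟨Continuous.mul (by fun_prop) hf.cont, fun k T => ?_⟩
  obtain ⟨C, hC⟩ := hf.decay (k + 1) T
  refine ⟨C, fun t x ht => ?_⟩
  refine le_trans ?_ (hC t x ht)
  rw [abs_mul, pow_succ, mul_assoc]
  gcongr
  exact abs_coord_le x j

lemma mul (hf : LocDecay f) (hg : LocDecay g) : LocDecay fun p => f p * g p := by
  refine ⟨hf.cont.mul hg.cont, fun k T => ?_⟩
  obtain ⟨C, hC⟩ := hf.decay k T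
  obtain ⟨D, hD⟩ := hg.decay 0 T
  refine ⟨C * D, fun t x ht => ?_⟩
  rw [abs_mul, ← mul_assoc]
  have h1 := hC t x ht
  have h2 := hD t x ht
  rw [pow_zero, one_mul] at h2
  exact mul_le_mul h1 h2 (abs_nonneg _) (le_trans (by positivity) h1)

lemma sum {ι : Type*} (s : Finset ι) {f : ι → ℝ × E3 → ℝ} (hf : ∀ i ∈ s, LocDecay (f i)) :
    LocDecay fun p => ∑ i ∈ s, f i p := by
  classical
  induction s using Finset.induction_on with
  | empty => exact ⟨by simpa using continuous_const, fun k T => ⟨0, by simp⟩⟩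
  | insert a s ha ih =>
    simp only [Finset.sum_insert ha]
    exact (hf a (by simp)).add (ih fun i hi => hf i (by simp [hi]))

lemma bound (hf : LocDecay f) (T : ℝ) :
    ∃ C : ℝ, 0 ≤ C ∧ ∀ (t : ℝ) (x : E3), |t| ≤ T → |f (t, x)| ≤ C * decayWeight x := by
  obtain ⟨C, hC⟩ := hf.decay 0 T
  obtain ⟨D, hD⟩ := hf.decay 4 T
  refine ⟨|8 * (C + D)|, abs_nonneg _, fun t x ht => ?_⟩
  refine (le_mul_decayWeight x (abs_nonneg _) (by simpa using hC t x ht) (hD t x ht)).trans ?_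
  gcongr
  · exact (decayWeight_pos x).le
  · exact le_abs_self _

lemma cont_slice (hf : LocDecay f) (t : ℝ) : Continuous fun x => f (t, x) :=
  hf.cont.comp (by fun_prop)

lemma integrable (hf : LocDecay f) (t : ℝ) : Integrable fun x => f (t, x) := by
  obtain ⟨C, -, hC⟩ := hf.bound |t|
  exact (integrable_decayWeight.const_mul C).mono' (hf.cont_slice t).aestronglyMeasurable
    (ae_of_all _ fun x => by simpa using hC t x le_rfl)

lemma hasDerivAt_integral {f' : ℝ × E3 → ℝ} (hf : LocDecay f) (hf' : LocDecay f')
    (h : ∀ t x, HasDerivAt (fun s => f (s, x)) (f' (t, x)) t) (t : ℝ) :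
    HasDerivAt (fun s => ∫ x, f (s, x)) (∫ x, f' (t, x)) t := by
  obtain ⟨C, -, hC⟩ := hf'.bound (|t| + 1)
  refine (hasDerivAt_integral_of_dominated_loc_of_deriv_le (Metric.ball_mem_nhds t one_pos)
    (bound := fun x => C * decayWeight x) (.of_forall fun s =>
      (hf.cont_slice s).aestronglyMeasurable) (hf.integrable t)
    (hf'.cont_slice t).aestronglyMeasurable (ae_of_all _ fun x s hs => ?_)
    (integrable_decayWeight.const_mul C) (ae_of_all _ fun x s _ => h s x)).2
  rw [Real.norm_eq_abs]
  refine hC s x ?_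
  rw [Metric.mem_ball, Real.dist_eq] at hs
  have : |s| ≤ |s - t| + |t| := by simpa using abs_add_le (s - t) t
  linarith

end LocDecay

/-- The integral over `ℝ³` of a directional derivative of an integrable function vanishes. -/
lemma integral_lineDeriv_eq_zero {f g : E3 → ℝ} {e : E3} (hf : Integrable f) (hg : Integrable g)
    (h : ∀ x, HasDerivAt (fun s : ℝ => f (x + s • e)) (g x) 0) : ∫ x, g x = 0 := by
  have := integral_bilinear_hasLineDerivAt_right_eq_neg_left_of_integrable (μ := volume)
    (f := fun _ : E3 => (1 : ℝ)) (f' := fun _ => 0) (g := f) (g' := g) (v := e)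
    (B := ContinuousLinearMap.mul ℝ ℝ) (by simp) (by simpa using hg) (by simpa using hf)
    (fun x _ => by simpa [HasLineDerivAt] using hasDerivAt_const (0:ℝ) (1:ℝ)) (fun x _ => h x)
  simpa using this

/-- Directional derivative on space-time. -/
def pd (a : ℝ × E3) (f : ℝ × E3 → ℝ) (p : ℝ × E3) : ℝ := fderiv ℝ f p a

/-- The time direction of space-time. -/
def timeDir : ℝ × E3 := (1, 0)

/-- The spatial coordinate directions of space-time. -/
def coordDir (j : Fin 3) : ℝ × E3 := (0, EuclideanSpace.single j 1)

/-- Smooth functions on space-time all of whose derivatives decay rapidly in space, locally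
uniformly in time. -/
structure RapidDecay (f : ℝ × E3 → ℝ) : Prop where
  smooth : ContDiff ℝ (⊤ : ℕ∞) f
  decay : ∀ (k n : ℕ) (T : ℝ), ∃ C : ℝ, ∀ (t : ℝ) (x : E3), |t| ≤ T →
    ‖x‖ ^ k * ‖iteratedFDeriv ℝ n f (t, x)‖ ≤ C

namespace RapidDecay

variable {f : ℝ × E3 → ℝ}

lemma of_clm {φ : ℝ → E3 → ℂ} {v : E3 → ℝ} (hφ : IsHartreeSolution v φ) (L : ℂ →L[ℝ] ℝ) :
    RapidDecay fun p => L (φ p.1 p.2) := by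
  refine ⟨L.contDiff.comp hφ.smooth, fun k n T => ?_⟩
  obtain ⟨C, hC⟩ := hφ.decay k n T
  refine ⟨‖L‖ * C, fun t x ht => ?_⟩
  have h := L.norm_iteratedFDeriv_comp_left (n := n)
    (N := (⊤ : ℕ∞)) (hφ.smooth.contDiffAt (x := (t, x))) (by exact_mod_cast le_top)
  calc _ ≤ ‖x‖ ^ k * (‖L‖ * ‖iteratedFDeriv ℝ n (fun p : ℝ × E3 => φ p.1 p.2) (t, x)‖) := by
        gcongr; exact h
    _ = ‖L‖ * (‖x‖ ^ k * ‖iteratedFDeriv ℝ n (fun p : ℝ × E3 => φ p.1 p.2) (t, x)‖) := by ring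
    _ ≤ _ := by gcongr; exact hC t x ht

lemma differentiable (hf : RapidDecay f) : Differentiable ℝ f :=
  hf.smooth.differentiable (by simp)

lemma pd (a : ℝ × E3) (hf : RapidDecay f) : RapidDecay (pd a f) := by
  have hs : ContDiff ℝ (⊤ : ℕ∞) (fderiv ℝ f) := hf.smooth.fderiv_right (by simp)
  refine ⟨hs.clm_apply contDiff_const, fun k n T => ?_⟩
  obtain ⟨C, hC⟩ := hf.decay k (n + 1) T
  let L : ((ℝ × E3) →L[ℝ] ℝ) →L[ℝ] ℝ := ContinuousLinearMap.apply ℝ ℝ a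
  refine ⟨‖L‖ * C, fun t x ht => ?_⟩
  have h := L.norm_iteratedFDeriv_comp_left (n := n)
    (N := (⊤ : ℕ∞)) (hs.contDiffAt (x := (t, x))) (by exact_mod_cast le_top)
  rw [norm_iteratedFDeriv_fderiv] at h
  calc _ ≤ ‖x‖ ^ k * (‖L‖ * ‖iteratedFDeriv ℝ (n + 1) f (t, x)‖) := by
        gcongr; exact h
    _ = ‖L‖ * (‖x‖ ^ k * ‖iteratedFDeriv ℝ (n + 1) f (t, x)‖) := by ring
    _ ≤ _ := by gcongr; exact hC t x ht

lemma locDecay (hf : RapidDecay f) : LocDecay f := by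
  refine ⟨hf.smooth.continuous, fun k T => ?_⟩
  obtain ⟨C, hC⟩ := hf.decay k 0 T
  exact ⟨C, fun t x ht => by simpa using hC t x ht⟩

lemma hasDerivAt_line (hf : RapidDecay f) (a p : ℝ × E3) :
    HasDerivAt (fun s : ℝ => f (p + s • a)) (_root_.pd a f p) 0 := by
  have h : HasDerivAt (fun s : ℝ => p + s • a) a 0 := by
    simpa using ((hasDerivAt_id (0 : ℝ)).smul_const a).const_add p
  have h' : HasFDerivAt f (fderiv ℝ f p) (p + (0 : ℝ) • a) := by
    simpa using (hf.differentiable p).hasFDerivAt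
  exact h'.comp_hasDerivAt 0 h

lemma pd_comm (hf : RapidDecay f) (a b : ℝ × E3) (p : ℝ × E3) :
    _root_.pd a (_root_.pd b f) p = _root_.pd b (_root_.pd a f) p := by
  have hd : DifferentiableAt ℝ (fderiv ℝ f) p :=
    (hf.smooth.fderiv_right (m := (⊤ : ℕ∞)) (by simp)).differentiable (by simp) p
  have key : ∀ a b : ℝ × E3, _root_.pd a (_root_.pd b f) p = fderiv ℝ (fderiv ℝ f) p a b := by
    intro a b
    have := (hd.hasFDerivAt.clm_apply (hasFDerivAt_const b p)).fderiv
    change fderiv ℝ (fun q => fderiv ℝ f q b) p a = _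
    rw [this]; simp
  rw [key, key]
  exact (hf.smooth.contDiffAt.isSymmSndFDerivAt (by simpa using ENat.LEInfty.out)) a b

end RapidDecay

/-- `f'` is the derivative of `f` in the direction `a` of space-time, and both functions decay
rapidly in space, locally uniformly in time. -/
structure DecayDeriv (a : ℝ × E3) (f f' : ℝ × E3 → ℝ) : Prop where
  left : LocDecay f
  right : LocDecay f'
  deriv : ∀ p, HasDerivAt (fun s : ℝ => f (p + s • a)) (f' p) 0

lemma RapidDecay.decayDeriv {f : ℝ × E3 → ℝ} (hf : RapidDecay f) (a : ℝ × E3) :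
    DecayDeriv a f (_root_.pd a f) :=
  ⟨hf.locDecay, (hf.pd a).locDecay, hf.hasDerivAt_line a⟩

namespace DecayDeriv

variable {a : ℝ × E3} {f f' g g' : ℝ × E3 → ℝ}

lemma add (hf : DecayDeriv a f f') (hg : DecayDeriv a g g') :
    DecayDeriv a (fun p => f p + g p) (fun p => f' p + g' p) :=
  ⟨hf.left.add hg.left, hf.right.add hg.right, fun p => (hf.deriv p).add (hg.deriv p)⟩

lemma sub (hf : DecayDeriv a f f') (hg : DecayDeriv a g g') :
    DecayDeriv a (fun p => f p - g p) (fun p => f' p - g' p) :=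
  ⟨hf.left.sub hg.left, hf.right.sub hg.right, fun p => (hf.deriv p).sub (hg.deriv p)⟩

lemma const_mul (c : ℝ) (hf : DecayDeriv a f f') :
    DecayDeriv a (fun p => c * f p) (fun p => c * f' p) :=
  ⟨hf.left.const_mul c, hf.right.const_mul c, fun p => (hf.deriv p).const_mul c⟩

lemma mul (hf : DecayDeriv a f f') (hg : DecayDeriv a g g') :
    DecayDeriv a (fun p => f p * g p) (fun p => f' p * g p + f p * g' p) := by
  refine ⟨hf.left.mul hg.left, (hf.right.mul hg.left).add (hf.left.mul hg.right), fun p => ?_⟩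
  simpa using (hf.deriv p).fun_mul (hg.deriv p)

lemma coord_mul (i : Fin 3) (hf : DecayDeriv a f f') :
    DecayDeriv a (fun p => p.2 i * f p) (fun p => a.2 i * f p + p.2 i * f' p) := by
  refine ⟨hf.left.coord_mul i, (hf.left.const_mul _).add (hf.right.coord_mul i), fun p => ?_⟩
  have h : HasDerivAt (fun s : ℝ => (p + s • a).2 i) (a.2 i) 0 := by
    simpa using ((hasDerivAt_id (0 : ℝ)).mul_const (a.2 i)).const_add (p.2 i)
  simpa using h.fun_mul (hf.deriv p)

lemma sum {f f' : Fin 3 → ℝ × E3 → ℝ} (hf : ∀ i, DecayDeriv a (f i) (f' i)) :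
    DecayDeriv a (fun p => ∑ i, f i p) (fun p => ∑ i, f' i p) :=
  ⟨.sum _ fun i _ => (hf i).left, .sum _ fun i _ => (hf i).right,
    fun p => .fun_sum fun i _ => (hf i).deriv p⟩

lemma hasDerivAt_time (hf : DecayDeriv timeDir f f') (t : ℝ) (x : E3) :
    HasDerivAt (fun s => f (s, x)) (f' (t, x)) t := by
  have h := hf.deriv (t, x)
  have h' : HasDerivAt (fun s : ℝ => f ((t, x) + s • timeDir)) (f' (t, x)) (t - t) := by
    simpa using h
  simpa [timeDir] using h'.comp_sub_const t t

lemma integral_eq_zero {j : Fin 3} (hf : DecayDeriv (coordDir j) f f') (t : ℝ) :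
    ∫ x, f' (t, x) = 0 := by
  refine integral_lineDeriv_eq_zero (e := EuclideanSpace.single j 1) (hf.left.integrable t)
    (hf.right.integrable t) fun x => ?_
  simpa [coordDir] using hf.deriv (t, x)

/-- The time derivative of the integral of a density satisfying a balance law with fluxes `X j`
and source `r`. -/
lemma hasDerivAt_integral {X Y : Fin 3 → ℝ × E3 → ℝ} {r : ℝ × E3 → ℝ}
    (hf : DecayDeriv timeDir f f') (hX : ∀ j, DecayDeriv (coordDir j) (X j) (Y j))
    (hr : ∀ p, f' p = ∑ j, Y j p + r p) (t : ℝ) :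
    Integrable (fun x => r (t, x)) ∧ HasDerivAt (fun s => ∫ x, f (s, x)) (∫ x, r (t, x)) t := by
  have h := hf.left.hasDerivAt_integral hf.right hf.hasDerivAt_time t
  have hY : Integrable fun x => ∑ j, Y j (t, x) :=
    integrable_finsetSum _ fun j _ => (hX j).right.integrable t
  have e : (fun x => r (t, x)) = fun x => f' (t, x) - ∑ j, Y j (t, x) := by
    ext x; rw [hr]; ring
  rw [e, integral_sub (hf.right.integrable t) hY,
    integral_finsetSum _ fun j _ => (hX j).right.integrable t]
  exact ⟨(hf.right.integrable t).sub hY, by simpa [fun j => (hX j).integral_eq_zero t] using h⟩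

end DecayDeriv

section Kernel

variable {κ : E3 → ℝ}

lemma integrable_kernel_mul {a b : E3 → ℝ} {A : ℝ} (hκ : Integrable κ) (ha : Continuous a)
    (hA : ∀ x, |a x| ≤ A) (hb : Integrable b) :
    Integrable fun z : E3 × E3 => κ (z.1 - z.2) * a z.1 * b z.2 := by
  have h := hb.convolution_integrand (ContinuousLinearMap.mul ℝ ℝ) hκ
  have h2 := h.bdd_mul (f := fun z : E3 × E3 => a z.1) (c := A)
    (ha.comp continuous_fst).aestronglyMeasurable (ae_of_all _ fun z => hA z.1)
  refine h2.congr (ae_of_all _ fun z => ?_)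
  simp only [ContinuousLinearMap.mul_apply']
  ring

lemma LocDecay.integrable_kernel {f g : ℝ × E3 → ℝ} (hκ : Integrable κ) (hf : LocDecay f)
    (hg : LocDecay g) (t : ℝ) :
    Integrable fun z : E3 × E3 => κ (z.1 - z.2) * f (t, z.1) * g (t, z.2) := by
  obtain ⟨C, hC0, hC⟩ := hf.bound |t|
  exact integrable_kernel_mul (A := C) hκ (hf.cont_slice t) (fun x => (hC t x le_rfl).trans
    (mul_le_of_le_one_right hC0 (decayWeight_le_one x))) (hg.integrable t)

lemma integral_kernel_swap (heven : ∀ x, κ (-x) = κ x) (a b : E3 → ℝ) :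
    ∫ z : E3 × E3, κ (z.1 - z.2) * a z.1 * b z.2 = ∫ z : E3 × E3, κ (z.1 - z.2) * b z.1 * a z.2 := by
  rw [Measure.volume_eq_prod, ← integral_prod_swap]
  refine integral_congr_ae (ae_of_all _ fun z => ?_)
  simp only [Prod.fst_swap, Prod.snd_swap]
  rw [← heven, neg_sub]
  ring

lemma LocDecay.hasDerivAt_kernel {f f' : ℝ × E3 → ℝ} (hκ : Integrable κ)
    (heven : ∀ x, κ (-x) = κ x) (hf : LocDecay f) (hf' : LocDecay f')
    (h : ∀ t x, HasDerivAt (fun s => f (s, x)) (f' (t, x)) t) (t : ℝ) :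
    HasDerivAt (fun s => ∫ z : E3 × E3, κ (z.1 - z.2) * f (s, z.1) * f (s, z.2))
      (2 * ∫ z : E3 × E3, κ (z.1 - z.2) * f' (t, z.1) * f (t, z.2)) t := by
  obtain ⟨C, hC0, hC⟩ := hf.bound (|t| + 1)
  obtain ⟨D, hD0, hD⟩ := hf'.bound (|t| + 1)
  have key := (hasDerivAt_integral_of_dominated_loc_of_deriv_le (μ := (volume : Measure (E3 × E3)))
    (F := fun s z => κ (z.1 - z.2) * f (s, z.1) * f (s, z.2))
    (F' := fun s z => κ (z.1 - z.2) * f' (s, z.1) * f (s, z.2)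
      + κ (z.1 - z.2) * f (s, z.1) * f' (s, z.2)) (x₀ := t)
    (Metric.ball_mem_nhds t one_pos)
    (bound := fun z => 2 * (C * D) * (|κ (z.1 - z.2)| * decayWeight z.1 * decayWeight z.2))
    (.of_forall fun s => (hf.integrable_kernel hκ hf s).aestronglyMeasurable)
    (hf.integrable_kernel hκ hf t)
    ((hf'.integrable_kernel hκ hf t).add (hf.integrable_kernel hκ hf' t)).aestronglyMeasurable
    (ae_of_all _ fun z s hs => ?_) ?_ (ae_of_all _ fun z s _ => ?_)).2
  · rwa [integral_add (hf'.integrable_kernel hκ hf t) (hf.integrable_kernel hκ hf' t),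
      integral_kernel_swap heven (fun x => f (t, x)) (fun x => f' (t, x)), ← two_mul] at key
  · have hs' : |s| ≤ |t| + 1 := by
      rw [Metric.mem_ball, Real.dist_eq] at hs
      have : |s| ≤ |s - t| + |t| := by simpa using abs_add_le (s - t) t
      linarith
    have prod_le : ∀ {a b A B : ℝ}, |a| ≤ A * decayWeight z.1 → |b| ≤ B * decayWeight z.2 →
        0 ≤ A → |κ (z.1 - z.2) * a * b|
          ≤ A * B * (|κ (z.1 - z.2)| * decayWeight z.1 * decayWeight z.2) := by
      intro a b A B ha hb hA
      rw [abs_mul, abs_mul]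
      calc _ ≤ |κ (z.1 - z.2)| * (A * decayWeight z.1) * (B * decayWeight z.2) := by
            have := (decayWeight_pos z.1).le
            gcongr
        _ = _ := by ring
    have h1 := prod_le (hD s z.1 hs') (hC s z.2 hs') hD0
    have h2 := prod_le (hC s z.1 hs') (hD s z.2 hs') hC0
    rw [Real.norm_eq_abs]
    refine (abs_add_le _ _).trans ?_
    linarith
  · exact (integrable_kernel_mul (A := 1) hκ.abs continuous_decayWeight (fun x => by
      rw [abs_of_pos (decayWeight_pos x)]; exact decayWeight_le_one x)
      integrable_decayWeight).const_mul _
  · have := ((h s z.1).const_mul (κ (z.1 - z.2))).mul (h s z.2)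
    exact this

/-- Schur's test for a convolution kernel. -/
lemma abs_integral_kernel_le {a : E3 → ℝ} (hκ : Integrable κ) (ha2 : Integrable fun x => a x ^ 2) :
    |∫ z : E3 × E3, κ (z.1 - z.2) * a z.1 * a z.2| ≤ (∫ x, |κ x|) * ∫ x, a x ^ 2 := by
  have i2 : Integrable fun z : E3 × E3 => |κ (z.1 - z.2)| * a z.2 ^ 2 := by
    simpa using integrable_kernel_mul (A := 1) hκ.abs (continuous_const (y := (1:ℝ))) (by simp) ha2
  have i1 : Integrable fun z : E3 × E3 => |κ (z.1 - z.2)| * a z.1 ^ 2 := by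
    have h := (integrable_kernel_mul (A := 1) hκ.comp_neg.abs (continuous_const (y := (1:ℝ)))
      (by simp) ha2).swap
    rw [Measure.volume_eq_prod]
    simpa [Function.comp_def] using h
  have e1 : ∫ z : E3 × E3, |κ (z.1 - z.2)| * a z.1 ^ 2 = (∫ x, |κ x|) * ∫ x, a x ^ 2 := by
    rw [Measure.volume_eq_prod] at i1 ⊢
    rw [integral_prod _ i1, ← integral_const_mul]
    refine integral_congr_ae (ae_of_all _ fun x => ?_)
    simp only
    rw [integral_mul_const, integral_sub_left_eq_self (fun y => |κ y|)]
  have e2 : ∫ z : E3 × E3, |κ (z.1 - z.2)| * a z.2 ^ 2 = (∫ x, |κ x|) * ∫ x, a x ^ 2 := by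
    rw [Measure.volume_eq_prod] at i2 ⊢
    rw [integral_prod_symm _ i2, ← integral_const_mul]
    refine integral_congr_ae (ae_of_all _ fun x => ?_)
    simp only
    rw [integral_mul_const, integral_sub_right_eq_self (fun y => |κ y|)]
  calc _ ≤ ∫ z : E3 × E3, (1 / 2) * (|κ (z.1 - z.2)| * a z.1 ^ 2 + |κ (z.1 - z.2)| * a z.2 ^ 2) := by
        rw [← Real.norm_eq_abs]
        refine norm_integral_le_of_norm_le ((i1.add i2).const_mul (1 / 2)) (ae_of_all _ fun z => ?_)
        rw [Real.norm_eq_abs, mul_assoc, abs_mul, ← mul_add, mul_left_comm]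
        gcongr
        rw [abs_le]
        constructor <;> nlinarith [sq_nonneg (a z.1 + a z.2), sq_nonneg (a z.1 - a z.2)]
    _ = _ := by rw [integral_const_mul, integral_add i1 i2, e1, e2]; ring

lemma integral_hartreeW_mul {φ : ℝ → E3 → ℂ} {g : ℝ × E3 → ℝ} (hκ : Integrable κ)
    (hn : LocDecay fun p => ‖φ p.1 p.2‖ ^ 2) (hg : LocDecay g) (t : ℝ) :
    ∫ x, hartreeW κ (φ t) x * g (t, x)
      = ∫ z : E3 × E3, κ (z.1 - z.2) * g (t, z.1) * ‖φ t z.2‖ ^ 2 := by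
  have hi := hg.integrable_kernel hκ hn t
  rw [Measure.volume_eq_prod] at hi ⊢
  rw [integral_prod _ hi]
  refine integral_congr_ae (ae_of_all _ fun x => ?_)
  simp only [hartreeW]
  rw [convolution_eq_swap, ← integral_mul_const]
  refine integral_congr_ae (ae_of_all _ fun y => ?_)
  simp only [ContinuousLinearMap.lsmul_apply, smul_eq_mul]
  ring

end Kernel

/-- Time derivative on space-time. -/
abbrev dt (f : ℝ × E3 → ℝ) : ℝ × E3 → ℝ := pd timeDir f

/-- Spatial partial derivatives on space-time. -/
abbrev dx (j : Fin 3) (f : ℝ × E3 → ℝ) : ℝ × E3 → ℝ := pd (coordDir j) f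

lemma timeDir_snd (i : Fin 3) : timeDir.2 i = 0 := rfl

lemma coordDir_snd (i j : Fin 3) : (coordDir j).2 i = if i = j then 1 else 0 := by
  simp [coordDir]

/-- The real form of the Schrödinger equation `i ∂ₜ φ + Δφ = Wφ` for `φ = u + iw`, with `u` and `w`
rapidly decaying. -/
structure SchrodingerPair (W u w : ℝ × E3 → ℝ) : Prop where
  re : RapidDecay u
  im : RapidDecay w
  dt_re : ∀ p, dt u p = -(∑ j, dx j (dx j w) p) + W p * w p
  dt_im : ∀ p, dt w p = ∑ j, dx j (dx j u) p - W p * u p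

namespace SchrodingerPair

variable {W u w : ℝ × E3 → ℝ}

/-- Conservation of mass. -/
lemma hasDerivAt_mass (h : SchrodingerPair W u w) (t : ℝ) :
    HasDerivAt (fun s => ∫ x, (u (s, x) * u (s, x) + w (s, x) * w (s, x))) 0 t := by
  have hu := h.re.decayDeriv
  have hw := h.im.decayDeriv
  have hux j := (h.re.pd (coordDir j)).decayDeriv
  have hwx j := (h.im.pd (coordDir j)).decayDeriv
  have key := DecayDeriv.hasDerivAt_integral (((hu timeDir).mul (hu _)).add ((hw _).mul (hw _)))
    (fun j => (((hw _).mul (hux j (coordDir j))).sub ((hu _).mul (hwx j _))).const_mul 2)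
    (r := fun _ => 0) (fun p => ?_) t
  · simpa using key.2
  · have e1 := h.dt_re p
    have e2 := h.dt_im p
    simp only [Fin.sum_univ_three] at e1 e2 ⊢
    linear_combination 2 * u p * e1 + 2 * w p * e2

/-- The virial identity. -/
lemma hasDerivAt_variance (h : SchrodingerPair W u w) (t : ℝ) :
    HasDerivAt (fun s => ∫ x : E3, ∑ i, x i * (x i * (u (s, x) * u (s, x) + w (s, x) * w (s, x))))
      (4 * ∫ x : E3, ∑ i, x i * (u (t, x) * dx i w (t, x) - w (t, x) * dx i u (t, x))) t := by
  have hu := h.re.decayDeriv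
  have hw := h.im.decayDeriv
  have hux j := (h.re.pd (coordDir j)).decayDeriv
  have hwx j := (h.im.pd (coordDir j)).decayDeriv
  have key := DecayDeriv.hasDerivAt_integral (DecayDeriv.sum fun i =>
      ((((hu timeDir).mul (hu _)).add ((hw _).mul (hw _))).coord_mul i).coord_mul i)
    (fun j => DecayDeriv.sum fun i =>
      ((((hw _).mul (hux j (coordDir j))).sub ((hu _).mul (hwx j _))).const_mul 2).coord_mul i
        |>.coord_mul i)
    (r := fun p => 4 * ∑ i, p.2 i * (u p * dx i w p - w p * dx i u p)) (fun p => ?_) t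
  · simpa only [integral_const_mul] using key.2
  · have e1 := h.dt_re p
    have e2 := h.dt_im p
    simp [timeDir_snd, coordDir_snd, Fin.sum_univ_three] at e1 e2 ⊢
    linear_combination (p.2 0 ^ 2 + p.2 1 ^ 2 + p.2 2 ^ 2) * (2 * u p * e1 + 2 * w p * e2)

/-- The time derivative of the kinetic energy. -/
lemma hasDerivAt_kinetic (h : SchrodingerPair W u w) (t : ℝ) :
    HasDerivAt (fun s => ∫ x : E3, ∑ i, (dx i u (s, x) * dx i u (s, x)
        + dx i w (s, x) * dx i w (s, x)))
      (-∫ x : E3, W (t, x) * (2 * (u (t, x) * dt u (t, x) + w (t, x) * dt w (t, x)))) t := by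
  have hut := (h.re.pd timeDir).decayDeriv
  have hwt := (h.im.pd timeDir).decayDeriv
  have hux j := (h.re.pd (coordDir j)).decayDeriv
  have hwx j := (h.im.pd (coordDir j)).decayDeriv
  have key := DecayDeriv.hasDerivAt_integral (DecayDeriv.sum fun i =>
      (((hux i timeDir).mul (hux i _)).add ((hwx i _).mul (hwx i _))))
    (fun j => (((hut (coordDir j)).mul (hux j (coordDir j))).add
      ((hwt _).mul (hwx j _))).const_mul 2)
    (r := fun p => -(W p * (2 * (u p * dt u p + w p * dt w p)))) (fun p => ?_) t
  · simpa only [integral_neg] using key.2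
  · have e1 := h.dt_re p
    have e2 := h.dt_im p
    have c1 j := h.re.pd_comm timeDir (coordDir j) p
    have c2 j := h.im.pd_comm timeDir (coordDir j) p
    simp only [Fin.sum_univ_three, c1, c2] at e1 e2 ⊢
    linear_combination 2 * dt u p * e2 - 2 * dt w p * e1

/-- The time derivative of the dilation momentum, with the potential not yet symmetrized. -/
lemma hasDerivAt_dilation (h : SchrodingerPair W u w) (t : ℝ) :
    HasDerivAt (fun s => ∫ x : E3, ∑ i, x i * (u (s, x) * dx i w (s, x) - w (s, x) * dx i u (s, x)))
      (2 * (∫ x : E3, ∑ i, (dx i u (t, x) * dx i u (t, x) + dx i w (t, x) * dx i w (t, x)))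
        + ∫ x : E3, W (t, x) * (3 * (u (t, x) * u (t, x) + w (t, x) * w (t, x))
          + ∑ i, x i * (2 * (u (t, x) * dx i u (t, x) + w (t, x) * dx i w (t, x))))) t := by
  have hu := h.re.decayDeriv
  have hw := h.im.decayDeriv
  have hut := (h.re.pd timeDir).decayDeriv
  have hwt := (h.im.pd timeDir).decayDeriv
  have hux j := (h.re.pd (coordDir j)).decayDeriv
  have hwx j := (h.im.pd (coordDir j)).decayDeriv
  have hf := DecayDeriv.sum fun i =>
    (((hu timeDir).mul (hwx i _)).sub ((hw _).mul (hux i _))).coord_mul i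
  have hX := fun j : Fin 3 =>
    (((((hu (coordDir j)).mul (hwt _)).sub ((hw _).mul (hut _))).coord_mul j).sub
      ((((hu _).mul (hux j _)).add ((hw _).mul (hwx j _))).const_mul 3)).sub
    (((DecayDeriv.sum fun i =>
      (((hux i _).mul (hux j _)).add ((hwx i _).mul (hwx j _))).coord_mul i).const_mul 2).sub
      ((DecayDeriv.sum fun i =>
        (((hux i _).mul (hux i _)).add ((hwx i _).mul (hwx i _)))).coord_mul j))
  have hd : LocDecay fun p => ∑ i, (dx i u p * dx i u p + dx i w p * dx i w p) :=
    .sum _ fun i _ => ((hux i timeDir).left.mul (hux i timeDir).left).add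
      ((hwx i timeDir).left.mul (hwx i timeDir).left)
  have key := DecayDeriv.hasDerivAt_integral hf hX
    (r := fun p => 2 * (∑ i, (dx i u p * dx i u p + dx i w p * dx i w p))
      + W p * (3 * (u p * u p + w p * w p)
          + ∑ i, p.2 i * (2 * (u p * dx i u p + w p * dx i w p)))) (fun p => ?_) t
  · have hWi : Integrable fun x : E3 => W (t, x) * (3 * (u (t, x) * u (t, x) + w (t, x) * w (t, x))
        + ∑ i, x i * (2 * (u (t, x) * dx i u (t, x) + w (t, x) * dx i w (t, x)))) := by
      exact (key.1.sub ((hd.integrable t).const_mul 2)).congr (ae_of_all _ fun x => by simp)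
    have key := key.2
    rw [integral_add ((hd.integrable t).const_mul 2) hWi, integral_const_mul] at key
    exact key
  · have e1 := h.dt_re p
    have e2 := h.dt_im p
    have c1 j := h.re.pd_comm timeDir (coordDir j) p
    have c2 j := h.im.pd_comm timeDir (coordDir j) p
    have d1 i j := h.re.pd_comm (coordDir i) (coordDir j) p
    have d2 i j := h.im.pd_comm (coordDir i) (coordDir j) p
    simp [Fin.sum_univ_three, timeDir_snd, coordDir_snd, c1, c2, d1 1 0, d1 2 0, d1 2 1,
      d2 1 0, d2 2 0, d2 2 1] at e1 e2 ⊢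
    linear_combination
      (3 * w p + 2 * (p.2 0 * dx 0 w p + p.2 1 * dx 1 w p + p.2 2 * dx 2 w p)) * e1
      - (3 * u p + 2 * (p.2 0 * dx 0 u p + p.2 1 * dx 1 u p + p.2 2 * dx 2 u p)) * e2

end SchrodingerPair

/-- Radial kernels on `ℝ³` with at most a Coulomb singularity. -/
def coulombKernel (η : ℝ → ℝ) (x : E3) : ℝ := ‖x‖⁻¹ * η ‖x‖

lemma coulombKernel_neg (η : ℝ → ℝ) (x : E3) : coulombKernel η (-x) = coulombKernel η x := by
  simp [coulombKernel]

lemma integrable_coulombKernel {η : ℝ → ℝ} (hη : Continuous η) (hs : HasCompactSupport η) :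
    Integrable (coulombKernel η) := by
  unfold coulombKernel
  rw [integrable_fun_norm_addHaar volume (f := fun r => r⁻¹ * η r)]
  have h : Integrable fun r : ℝ => r * η r :=
    (continuous_id.mul hη).integrable_of_hasCompactSupport hs.mul_left
  refine h.integrableOn.congr_fun (fun r hr => ?_) measurableSet_Ioi
  have : r ≠ 0 := ne_of_gt hr
  simp
  field_simp

lemma LocDecay.dilate {g : ℝ × E3 → ℝ} (hg : LocDecay g) (t : ℝ) :
    LocDecay fun p => Real.exp (3 * p.1) * g (t, Real.exp p.1 • p.2) := by
  refine ⟨Continuous.mul (by fun_prop) (hg.cont.comp (by fun_prop)), fun k T => ?_⟩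
  obtain ⟨C, hC⟩ := hg.decay k |t|
  refine ⟨Real.exp ((3 + k) * T) * C, fun s x hs => ?_⟩
  have h := hC t (Real.exp s • x) le_rfl
  rw [norm_smul, Real.norm_eq_abs, Real.abs_exp, mul_pow, ← Real.exp_nat_mul] at h
  have e : ‖x‖ ^ k * |Real.exp (3 * s) * g (t, Real.exp s • x)|
      = Real.exp (3 * s - k * s) * (Real.exp (k * s) * ‖x‖ ^ k * |g (t, Real.exp s • x)|) := by
    rw [abs_mul, Real.abs_exp, Real.exp_sub]
    field_simp
  rw [e]
  refine mul_le_mul (Real.exp_le_exp.2 ?_) h (by positivity) (Real.exp_pos _).le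
  have h1 := abs_le.1 hs
  nlinarith [mul_nonneg (Nat.cast_nonneg (α := ℝ) k) (by linarith : 0 ≤ T + s)]

lemma RapidDecay.hasDerivAt_dilate {f : ℝ × E3 → ℝ} (hf : RapidDecay f) (t s : ℝ) (x : E3) :
    HasDerivAt (fun s => f (t, Real.exp s • x))
      (∑ i, (Real.exp s • x) i * dx i f (t, Real.exp s • x)) s := by
  have h := (hf.differentiable (t, Real.exp s • x)).hasFDerivAt.comp_hasDerivAt s
    ((hasDerivAt_const s t).prodMk ((Real.hasDerivAt_exp s).smul_const x))
  refine h.congr_deriv ?_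
  have e : ((0 : ℝ), Real.exp s • x) = ∑ i, (Real.exp s • x) i • coordDir i := by
    ext j
    · simp [coordDir, Fin.sum_univ_three]
    · simp [coordDir, Fin.sum_univ_three]
      fin_cases j <;> simp
  rw [e, map_sum]
  simp [dx, _root_.pd]

/-- The dilation identity for the Coulomb-type interaction energy. -/
lemma integral_coulombKernel_dilation {χ : ℝ → ℝ} (hχ : ContDiff ℝ (⊤ : ℕ∞) χ)
    (hs : HasCompactSupport χ) {u w : ℝ × E3 → ℝ} (hu : RapidDecay u) (hw : RapidDecay w) (t : ℝ) :
    2 * ∫ z : E3 × E3, coulombKernel χ (z.1 - z.2)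
        * (3 * (u (t, z.1) * u (t, z.1) + w (t, z.1) * w (t, z.1))
          + ∑ i, z.1 i * (2 * (u (t, z.1) * dx i u (t, z.1) + w (t, z.1) * dx i w (t, z.1))))
        * (u (t, z.2) * u (t, z.2) + w (t, z.2) * w (t, z.2))
      = ∫ z : E3 × E3, coulombKernel (fun r => χ r - r * deriv χ r) (z.1 - z.2)
        * (u (t, z.1) * u (t, z.1) + w (t, z.1) * w (t, z.1))
        * (u (t, z.2) * u (t, z.2) + w (t, z.2) * w (t, z.2)) := by
  set n : ℝ × E3 → ℝ := fun p => u p * u p + w p * w p with hn_def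
  set g : ℝ × E3 → ℝ := fun p => 3 * n p
    + ∑ i, p.2 i * (2 * (u p * dx i u p + w p * dx i w p)) with hg_def
  have hn : LocDecay n := (hu.locDecay.mul hu.locDecay).add (hw.locDecay.mul hw.locDecay)
  have hg : LocDecay g := (hn.const_mul 3).add (.sum _ fun i _ => (((hu.locDecay.mul
    (hu.pd _).locDecay).add (hw.locDecay.mul (hw.pd _).locDecay)).const_mul 2).coord_mul i)
  have hχ' : Continuous (deriv χ) := hχ.continuous_deriv (by simp)
  have hκ := integrable_coulombKernel hχ.continuous hs
  have hder : ∀ s x, HasDerivAt (fun s => Real.exp (3 * s) * n (t, Real.exp s • x))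
      (Real.exp (3 * s) * g (t, Real.exp s • x)) s := by
    intro s x
    have h3 : HasDerivAt (fun s : ℝ => Real.exp (3 * s)) (Real.exp (3 * s) * 3) s := by
      simpa using ((hasDerivAt_id s).const_mul 3).exp
    have h1 := hu.hasDerivAt_dilate t s x
    have h2 := hw.hasDerivAt_dilate t s x
    refine (h3.mul ((h1.fun_mul h1).fun_add (h2.fun_mul h2))).congr_deriv ?_
    simp only [hg_def, hn_def, Fin.sum_univ_three]
    ring
  have hJ := LocDecay.hasDerivAt_kernel hκ (coulombKernel_neg χ) (hn.dilate t) (hg.dilate t)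
    hder 0
  have hscale : ∀ s : ℝ, ∫ z : E3 × E3, coulombKernel χ (z.1 - z.2)
      * (Real.exp (3 * s) * n (t, Real.exp s • z.1)) * (Real.exp (3 * s) * n (t, Real.exp s • z.2))
      = ∫ z : E3 × E3, coulombKernel (fun r => Real.exp s * χ (Real.exp (-s) * r)) (z.1 - z.2)
        * n (t, z.1) * n (t, z.2) := by
    intro s
    have : (volume : Measure (E3 × E3)).IsAddHaarMeasure :=
      inferInstanceAs ((volume : Measure E3).prod volume).IsAddHaarMeasure
    have h := Measure.integral_comp_smul (volume : Measure (E3 × E3))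
      (fun z => coulombKernel (fun r => Real.exp s * χ (Real.exp (-s) * r)) (z.1 - z.2)
        * n (t, z.1) * n (t, z.2)) (Real.exp s)
    have hfr : Module.finrank ℝ (E3 × E3) = 6 := by simp
    rw [hfr, abs_of_pos (by positivity), smul_eq_mul, eq_inv_mul_iff_mul_eq₀ (by positivity)] at h
    rw [← h, ← integral_const_mul]
    refine integral_congr_ae (ae_of_all _ fun z => ?_)
    have e6 : Real.exp s ^ 6 = Real.exp (3 * s) * Real.exp (3 * s) := by
      rw [← Real.exp_add, ← Real.exp_nat_mul]; congr 1; push_cast; ring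
    simp only [Prod.smul_fst, Prod.smul_snd, coulombKernel, ← smul_sub, norm_smul,
      Real.norm_eq_abs, Real.abs_exp, e6]
    have e0 : Real.exp (-s) * (Real.exp s * ‖z.1 - z.2‖) = ‖z.1 - z.2‖ := by
      rw [Real.exp_neg, inv_mul_cancel_left₀ (Real.exp_pos s).ne']
    rw [e0, mul_inv]
    field_simp
  have hL : HasDerivAt (fun s => ∫ z : E3 × E3,
      coulombKernel (fun r => Real.exp s * χ (Real.exp (-s) * r)) (z.1 - z.2)
        * n (t, z.1) * n (t, z.2))
      (∫ z : E3 × E3, coulombKernel (fun r => χ r - r * deriv χ r) (z.1 - z.2)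
        * n (t, z.1) * n (t, z.2)) 0 := by
    have hcs : ∀ s : ℝ, HasCompactSupport fun r => Real.exp s * χ (Real.exp (-s) * r) := fun s =>
      (hs.comp_smul (Real.exp_pos (-s)).ne').mul_left
    obtain ⟨C₀, hC₀⟩ := hs.exists_bound_of_continuous hχ.continuous
    obtain ⟨C₁, hC₁⟩ := hs.deriv.exists_bound_of_continuous hχ'
    obtain ⟨R, hR⟩ : ∃ R : ℝ, ∀ r, R < |r| → χ r = 0 ∧ deriv χ r = 0 := by
      obtain ⟨R, hR⟩ := hs.isCompact.isBounded.exists_norm_le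
      refine ⟨R, fun r hr => ⟨?_, ?_⟩⟩
      · exact image_eq_zero_of_notMem_tsupport fun h => absurd (hR r h) (not_le.2 hr)
      · by_contra h
        exact absurd (hR r (support_deriv_subset h)) (not_le.2 hr)
    have hR0 : (0:ℝ) < |R| + 1 := by positivity
    set B : ℝ := 3 * |C₀| + 3 * (|R| + 1) * |C₁| with hB
    set η : ℝ → ℝ := fun r => B * max 0 (2 - |r| / (3 * (|R| + 1))) with hη
    have hηs : HasCompactSupport η := by
      refine HasCompactSupport.intro (isCompact_Icc (a := -(6 * (|R| + 1))) (b := 6 * (|R| + 1)))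
        fun r hr => ?_
      have : 6 * (|R| + 1) < |r| := by
        by_contra! h
        exact hr (abs_le.1 h)
      have h2 : 2 - |r| / (3 * (|R| + 1)) ≤ 0 := by
        rw [sub_nonpos, le_div_iff₀ (by positivity)]; linarith
      simp [hη, max_eq_left h2]
    have hηc : Continuous η := by fun_prop
    have key := (hasDerivAt_integral_of_dominated_loc_of_deriv_le
      (μ := (volume : Measure (E3 × E3))) (x₀ := (0:ℝ))
      (F := fun s z => coulombKernel (fun r => Real.exp s * χ (Real.exp (-s) * r)) (z.1 - z.2)
        * n (t, z.1) * n (t, z.2))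
      (F' := fun s z => coulombKernel (fun r => Real.exp s * χ (Real.exp (-s) * r)
        - r * deriv χ (Real.exp (-s) * r)) (z.1 - z.2) * n (t, z.1) * n (t, z.2))
      (Metric.ball_mem_nhds 0 one_pos)
      (bound := fun z => ‖coulombKernel η (z.1 - z.2) * n (t, z.1) * n (t, z.2)‖)
      (.of_forall fun s => (hn.integrable_kernel (integrable_coulombKernel
        (continuous_const.mul (hχ.continuous.comp (by fun_prop))) (hcs s)) hn
        t).aestronglyMeasurable)
      (hn.integrable_kernel (integrable_coulombKernel
        (continuous_const.mul (hχ.continuous.comp (by fun_prop))) (hcs 0)) hn t)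
      ?_ (ae_of_all _ fun z s hs1 => ?_)
      (hn.integrable_kernel (integrable_coulombKernel hηc hηs) hn t).norm
      (ae_of_all _ fun z s _ => ?_)).2
    · simpa using key
    · simp only [neg_zero, Real.exp_zero, one_mul]
      exact (hn.integrable_kernel (integrable_coulombKernel (hχ.continuous.sub
        (continuous_id.mul hχ')) (hs.sub hs.deriv.mul_left)) hn t).aestronglyMeasurable
    · rw [Metric.mem_ball, dist_zero_right, Real.norm_eq_abs, abs_lt] at hs1
      rw [norm_mul, norm_mul, norm_mul (coulombKernel η _ * _), norm_mul (coulombKernel η _)]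
      gcongr ?_ * _ * _
      simp only [coulombKernel, norm_mul]
      gcongr ?_ * ?_
      set r := ‖z.1 - z.2‖ with hr
      have hr0 : 0 ≤ r := norm_nonneg _
      have hB0 : 0 ≤ B := by positivity
      have he : Real.exp s ≤ 3 := by
        have := Real.exp_one_lt_three
        exact (Real.exp_le_exp.2 hs1.2.le).trans this.le
      rcases lt_or_ge (3 * (|R| + 1)) r with h | h
      · have hlt : R < |Real.exp (-s) * r| := by
          rw [abs_mul, Real.abs_exp, abs_of_nonneg hr0, Real.exp_neg, inv_mul_eq_div,
            lt_div_iff₀ (Real.exp_pos s)]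
          have h1 := le_abs_self R
          have h2 := Real.exp_pos s
          nlinarith [abs_nonneg R]
        simp [(hR _ hlt).1, (hR _ hlt).2]
      · have h1 : B ≤ ‖η r‖ := by
          rw [Real.norm_eq_abs]
          refine le_trans ?_ (le_abs_self _)
          simp only [hη]
          refine le_mul_of_one_le_right hB0 (le_max_of_le_right ?_)
          rw [abs_of_nonneg hr0]
          have : r / (3 * (|R| + 1)) ≤ 1 := by rw [div_le_one (by positivity)]; exact h
          linarith
        refine le_trans ?_ h1
        refine (norm_sub_le _ _).trans ?_
        rw [norm_mul, norm_mul, Real.norm_eq_abs, Real.abs_exp, Real.norm_of_nonneg hr0]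
        have h2 := (hC₀ (Real.exp (-s) * r)).trans (le_abs_self C₀)
        have h3 := (hC₁ (Real.exp (-s) * r)).trans (le_abs_self C₁)
        rw [hB]
        gcongr
    · refine HasDerivAt.mul_const (HasDerivAt.mul_const (HasDerivAt.const_mul _ ?_) _) _
      set r := ‖z.1 - z.2‖ with hr
      have h1 : HasDerivAt (fun s => Real.exp (-s) * r) (-(Real.exp (-s) * r)) s := by
        simpa using ((hasDerivAt_neg s).exp.mul_const r)
      have h2 := ((hχ.differentiable (by simp) (Real.exp (-s) * r)).hasDerivAt).comp s h1
      refine ((Real.hasDerivAt_exp s).mul h2).congr_deriv ?_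
      simp only [Function.comp]
      have : Real.exp s * Real.exp (-s) = 1 := by rw [← Real.exp_add]; simp
      linear_combination (-(r * deriv χ (Real.exp (-s) * r))) * this
  simp only [hscale] at hJ
  have := hJ.unique hL
  simpa [hg_def, hn_def] using this

/-- Smooth cut-offs at scale `m + 1`, with gradients of size `O(1 / (m + 1))`. -/
lemma exists_cutoff_seq : ∃ (c : ℝ) (η : ℕ → E3 → ℝ), 0 ≤ c ∧
    (∀ m, ContDiff ℝ 1 (η m)) ∧ (∀ m, HasCompactSupport (η m)) ∧ (∀ m x, |η m x| ≤ 1) ∧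
    (∀ m x, ‖fderiv ℝ (η m) x‖ ≤ c / (m + 1)) ∧
    ∀ x, Filter.Tendsto (fun m => η m x) Filter.atTop (nhds 1) := by
  let b : ContDiffBump (0 : E3) := ⟨1, 2, one_pos, one_lt_two⟩
  have hb : ContDiff ℝ 1 b := b.contDiff
  obtain ⟨c, hc⟩ := b.hasCompactSupport.fderiv (𝕜 := ℝ) |>.exists_bound_of_continuous
    (hb.continuous_fderiv one_ne_zero)
  refine ⟨c, fun m x => b ((m + 1 : ℝ)⁻¹ • x), (norm_nonneg _).trans (hc 0), fun m => ?_,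
    fun m => ?_, fun m x => ?_, fun m x => ?_, fun x => ?_⟩
  · exact hb.comp (contDiff_const_smul _)
  · exact b.hasCompactSupport.comp_smul (by positivity)
  · rw [abs_of_nonneg b.nonneg]
    exact b.le_one
  · rw [fderiv_comp_smul, norm_smul, Real.norm_of_nonneg (by positivity), div_eq_inv_mul]
    gcongr
    exact hc _
  · refine tendsto_const_nhds.congr' ?_
    filter_upwards [Filter.eventually_ge_atTop ⌈‖x‖⌉₊] with m hm
    refine (b.one_of_mem_closedBall ?_).symm
    rw [mem_closedBall_zero_iff, norm_smul, Real.norm_of_nonneg (by positivity), ← div_eq_inv_mul]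
    have : ‖x‖ ≤ m := (Nat.le_ceil _).trans (by exact_mod_cast hm)
    exact (div_le_one (by positivity)).2 (by linarith)

/-- The Sobolev inequality `‖f‖₆ ≤ C ‖∇f‖₂` on `ℝ³` for square-integrable functions. -/
lemma eLpNorm_six_le (f : E3 → ℝ) (hf : ContDiff ℝ 1 f) (hf2 : MemLp f 2) :
    eLpNorm f 6 volume ≤ eLpNormLESNormFDerivOfEqInnerConst (volume : Measure E3) 2
      * eLpNorm (fderiv ℝ f) 2 volume := by
  obtain ⟨c, η, hc, hη, hηs, hη1, hηd, hηt⟩ := exists_cutoff_seq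
  set K : NNReal := eLpNormLESNormFDerivOfEqInnerConst (volume : Measure E3) 2
  have hfd : Continuous (fderiv ℝ f) := hf.continuous_fderiv one_ne_zero
  have hbound : ∀ m, eLpNorm (fun x => η m x * f x) 6 volume
      ≤ K * (eLpNorm (fderiv ℝ f) 2 volume
        + ENNReal.ofReal (c / (m + 1)) * eLpNorm f 2 volume) := by
    intro m
    have h := eLpNorm_le_eLpNorm_fderiv_of_eq_inner (volume : Measure E3)
      (u := fun x => η m x * f x) ((hη m).mul hf) (hηs m).mul_right (p := 2) (p' := 6)
      (by norm_num) (by simp) (by simp; norm_num)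
    refine h.trans (mul_le_mul_right ?_ _)
    have h1 : eLpNorm (fderiv ℝ fun x => η m x * f x) 2 volume
        ≤ eLpNorm (fun x => ‖fderiv ℝ f x‖ + (c / (m + 1)) * ‖f x‖) 2 volume := by
      refine eLpNorm_mono_real fun x => ?_
      rw [fderiv_fun_mul ((hη m).differentiable one_ne_zero x) (hf.differentiable one_ne_zero x)]
      refine (norm_add_le _ _).trans ?_
      rw [norm_smul, norm_smul, mul_comm ‖f x‖]
      gcongr
      · exact mul_le_of_le_one_left (norm_nonneg _) (hη1 m x)
      · exact hηd m x
    refine h1.trans ((eLpNorm_add_le hfd.norm.aestronglyMeasurable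
      (hf.continuous.norm.const_mul _).aestronglyMeasurable (by norm_num)).trans ?_)
    rw [eLpNorm_norm]
    gcongr
    have h2 := eLpNorm_const_smul_le (c := c / (m + 1)) (f := fun x => ‖f x‖) (p := 2)
      (μ := (volume : Measure E3))
    rw [eLpNorm_norm, Real.enorm_of_nonneg (by positivity)] at h2
    exact h2
  have hlim := Lp.eLpNorm_lim_le_liminf_eLpNorm (μ := (volume : Measure E3)) (p := 6)
    (f := fun m x => η m x * f x)
    (fun m => ((hη m).continuous.mul hf.continuous).aestronglyMeasurable) f
    (ae_of_all _ fun x => by simpa using (hηt x).mul_const (f x))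
  refine hlim.trans ((Filter.liminf_le_liminf (.of_forall hbound)).trans (le_of_eq ?_))
  refine Filter.Tendsto.liminf_eq ?_
  have h0 : Filter.Tendsto (fun m : ℕ => ENNReal.ofReal (c / (m + 1)) * eLpNorm f 2 volume)
      Filter.atTop (nhds 0) := by
    have h1 : Filter.Tendsto (fun m : ℕ => c / ((m : ℝ) + 1)) Filter.atTop (nhds 0) :=
      tendsto_const_nhds.div_atTop
        (Filter.tendsto_atTop_add_const_right _ _ tendsto_natCast_atTop_atTop)
    have h2 := ENNReal.Tendsto.mul_const (ENNReal.tendsto_ofReal h1) (.inr hf2.2.ne)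
    simpa using h2
  have h3 := ENNReal.Tendsto.const_mul (a := (K : ENNReal))
    (h0.const_add (eLpNorm (fderiv ℝ f) 2 volume)) (.inr ENNReal.coe_ne_top)
  simpa using h3

lemma sq_norm_le_sum_sq (L : E3 →L[ℝ] ℝ) :
    ‖L‖ ^ 2 ≤ ∑ j, L (EuclideanSpace.single j 1) ^ 2 := by
  rw [← Real.le_sqrt (norm_nonneg _) (by positivity)]
  refine L.opNorm_le_bound (Real.sqrt_nonneg _) fun x => ?_
  have e : L x = ∑ j, L (EuclideanSpace.single j 1) * x j := by
    have h : x = ∑ j, x j • EuclideanSpace.single j (1 : ℝ) := by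
      ext i
      simp [Fin.sum_univ_three]
      fin_cases i <;> simp
    conv_lhs => rw [h]
    simp [mul_comm]
  rw [e, EuclideanSpace.norm_eq, ← Real.sqrt_mul (by positivity), Real.norm_eq_abs]
  refine Real.abs_le_sqrt ?_
  simpa using Finset.sum_mul_sq_le_sq_mul_sq Finset.univ
    (fun j => L (EuclideanSpace.single j 1)) fun j => x j

/-- The Sobolev inequality with Bochner integrals. -/
lemma exists_integral_pow_six_le : ∃ C : ℝ, 0 ≤ C ∧ ∀ (f G : E3 → ℝ), ContDiff ℝ 1 f →
    Integrable (fun x => f x ^ 2) → Integrable (fun x => f x ^ 6) → Integrable G →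
    (∀ x, ∑ j, fderiv ℝ f x (EuclideanSpace.single j 1) ^ 2 ≤ G x) →
    ∫ x, f x ^ 6 ≤ C * (∫ x, G x) ^ 3 := by
  set K : NNReal := eLpNormLESNormFDerivOfEqInnerConst (volume : Measure E3) 2 with hK
  refine ⟨(K : ℝ) ^ 6, by positivity, fun f G hf h2 h6 hG hle => ?_⟩
  have hL2 : MemLp f 2 := (memLp_two_iff_integrable_sq hf.continuous.aestronglyMeasurable).2 h2
  have hS := eLpNorm_six_le f hf hL2
  have hG0 : ∀ x, 0 ≤ G x := fun x => le_trans (by positivity) (hle x)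
  have e6 : eLpNorm f 6 volume ^ 6 = ENNReal.ofReal (∫ x, f x ^ 6) := by
    have h := eLpNorm_nnreal_pow_eq_lintegral (μ := (volume : Measure E3)) (f := f) (p := 6)
      (by norm_num)
    rw [ofReal_integral_eq_lintegral_ofReal h6 (ae_of_all _ fun x => by positivity)]
    have h' : eLpNorm f 6 volume ^ 6 = ∫⁻ x, ‖f x‖ₑ ^ 6 := by
      simpa using h
    rw [h']
    refine lintegral_congr fun x => ?_
    rw [← ofReal_norm, ← ENNReal.ofReal_pow (norm_nonneg _), Real.norm_eq_abs,
      Even.pow_abs (by decide)]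
  have e2 : eLpNorm (fderiv ℝ f) 2 volume ^ 2 ≤ ENNReal.ofReal (∫ x, G x) := by
    have h := eLpNorm_nnreal_pow_eq_lintegral (μ := (volume : Measure E3)) (f := fderiv ℝ f)
      (p := 2) (by norm_num)
    have h' : eLpNorm (fderiv ℝ f) 2 volume ^ 2 = ∫⁻ x, ‖fderiv ℝ f x‖ₑ ^ 2 := by
      simpa using h
    rw [ofReal_integral_eq_lintegral_ofReal hG (ae_of_all _ hG0), h']
    refine lintegral_mono fun x => ?_
    rw [← ofReal_norm, ← ENNReal.ofReal_pow (norm_nonneg _)]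
    exact ENNReal.ofReal_le_ofReal ((sq_norm_le_sum_sq _).trans (hle x))
  have hI : 0 ≤ ∫ x, G x := integral_nonneg hG0
  rw [← ENNReal.ofReal_le_ofReal_iff (by positivity), ← e6, ENNReal.ofReal_mul (by positivity),
    ENNReal.ofReal_pow hI, ENNReal.ofReal_pow K.coe_nonneg, ENNReal.ofReal_coe_nnreal]
  calc eLpNorm f 6 volume ^ 6 ≤ (K * eLpNorm (fderiv ℝ f) 2 volume) ^ 6 := by gcongr
    _ = K ^ 6 * (eLpNorm (fderiv ℝ f) 2 volume ^ 2) ^ 3 := by ring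
    _ ≤ _ := by gcongr

lemma LocDecay.bounded_mul {f : ℝ × E3 → ℝ} {b : E3 → ℝ} (hf : LocDecay f) (hb : Continuous b)
    (hb1 : ∀ x, |b x| ≤ 1) : LocDecay fun p => b p.2 * f p := by
  refine ⟨(hb.comp continuous_snd).mul hf.cont, fun k T => ?_⟩
  obtain ⟨C, hC⟩ := hf.decay k T
  refine ⟨C, fun t x ht => le_trans ?_ (hC t x ht)⟩
  rw [abs_mul]
  gcongr
  exact mul_le_of_le_one_left (abs_nonneg _) (hb1 x)

/-- The density of `‖x φ + 2it ∇φ‖²` for `φ = u + iw`. -/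
def pseudoDensity (u w : ℝ × E3 → ℝ) (t : ℝ) (x : E3) : ℝ :=
  ∑ j, ((2 * t * dx j u (t, x) + x j * w (t, x)) ^ 2 + (2 * t * dx j w (t, x) - x j * u (t, x)) ^ 2)

lemma integrable_pseudoDensity {u w : ℝ × E3 → ℝ} (hu : RapidDecay u) (hw : RapidDecay w) (t : ℝ) :
    Integrable (pseudoDensity u w t) := by
  have h1 j := ((hu.pd (coordDir j)).locDecay.const_mul (2 * t)).add (hw.locDecay.coord_mul j)
  have h2 j := ((hw.pd (coordDir j)).locDecay.const_mul (2 * t)).sub (hu.locDecay.coord_mul j)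
  have h := LocDecay.sum Finset.univ fun j _ => ((h1 j).mul (h1 j)).add ((h2 j).mul (h2 j))
  refine (h.integrable t).congr (ae_of_all _ fun x => ?_)
  simp only [pseudoDensity, sq]

lemma RapidDecay.neg {f : ℝ × E3 → ℝ} (hf : RapidDecay f) : RapidDecay fun p => -f p := by
  refine ⟨hf.smooth.neg, fun k n T => ?_⟩
  obtain ⟨C, hC⟩ := hf.decay k n T
  refine ⟨C, fun t x ht => ?_⟩
  have h : iteratedFDeriv ℝ n (fun p => -f p) (t, x) = -iteratedFDeriv ℝ n f (t, x) :=
    iteratedFDeriv_neg_apply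
  rw [h, norm_neg]
  exact hC t x ht

lemma pseudoDensity_rotate (u w : ℝ × E3 → ℝ) (t : ℝ) (x : E3) :
    pseudoDensity w (fun p => -u p) t x = pseudoDensity u w t x := by
  have h : ∀ j p, dx j (fun p => -u p) p = -dx j u p := fun j p => by
    simp [dx, pd, fderiv_fun_neg]
  simp only [pseudoDensity, h]
  exact Finset.sum_congr rfl fun j _ => by ring

/-- The Sobolev inequality for the real part of `exp (-i ‖x‖ ^ 2 / (4 t)) (u + i w)`. -/
lemma exists_integral_gauge_pow_six_le : ∃ C : ℝ, 0 ≤ C ∧ ∀ (u w : ℝ × E3 → ℝ) (t : ℝ),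
    RapidDecay u → RapidDecay w → 0 < t →
    Integrable (fun x : E3 => (Real.cos (‖x‖ ^ 2 / (4 * t)) * u (t, x)
      + Real.sin (‖x‖ ^ 2 / (4 * t)) * w (t, x)) ^ 6) ∧
    ∫ x : E3, (Real.cos (‖x‖ ^ 2 / (4 * t)) * u (t, x)
        + Real.sin (‖x‖ ^ 2 / (4 * t)) * w (t, x)) ^ 6
      ≤ C * ((4 * t ^ 2)⁻¹ * ∫ x, pseudoDensity u w t x) ^ 3 := by
  obtain ⟨C, hC, hS⟩ := exists_integral_pow_six_le
  refine ⟨C, hC, fun u w t hu hw ht => ?_⟩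
  have ha : LocDecay fun p => Real.cos (‖p.2‖ ^ 2 / (4 * t)) * u p
      + Real.sin (‖p.2‖ ^ 2 / (4 * t)) * w p :=
    (hu.locDecay.bounded_mul (b := fun x => Real.cos (‖x‖ ^ 2 / (4 * t))) (by fun_prop)
      fun x => Real.abs_cos_le_one _).add
    (hw.locDecay.bounded_mul (b := fun x => Real.sin (‖x‖ ^ 2 / (4 * t))) (by fun_prop)
      fun x => Real.abs_sin_le_one _)
  have h2 : Integrable fun x : E3 => (Real.cos (‖x‖ ^ 2 / (4 * t)) * u (t, x)
      + Real.sin (‖x‖ ^ 2 / (4 * t)) * w (t, x)) ^ 2 :=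
    ((ha.mul ha).integrable t).congr (ae_of_all _ fun x => by simp only; ring)
  have h6 : Integrable fun x : E3 => (Real.cos (‖x‖ ^ 2 / (4 * t)) * u (t, x)
      + Real.sin (‖x‖ ^ 2 / (4 * t)) * w (t, x)) ^ 6 :=
    (((ha.mul ha).mul ((ha.mul ha).mul (ha.mul ha))).integrable t).congr
      (ae_of_all _ fun x => by simp only; ring)
  refine ⟨h6, ?_⟩
  have hsm : ContDiff ℝ 1 fun x : E3 => Real.cos (‖x‖ ^ 2 / (4 * t)) * u (t, x)
      + Real.sin (‖x‖ ^ 2 / (4 * t)) * w (t, x) := by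
    have hθ : ContDiff ℝ 1 fun x : E3 => ‖x‖ ^ 2 / (4 * t) := (contDiff_norm_sq ℝ).div_const _
    have hu1 : ContDiff ℝ 1 fun x : E3 => u (t, x) :=
      (hu.smooth.of_le (by exact_mod_cast le_top)).comp (contDiff_const.prodMk contDiff_id)
    have hw1 : ContDiff ℝ 1 fun x : E3 => w (t, x) :=
      (hw.smooth.of_le (by exact_mod_cast le_top)).comp (contDiff_const.prodMk contDiff_id)
    exact (hθ.cos.mul hu1).add (hθ.sin.mul hw1)
  have h := hS _ (fun x => (4 * t ^ 2)⁻¹ * pseudoDensity u w t x) hsm h2 h6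
    ((integrable_pseudoDensity hu hw t).const_mul _) fun x => ?_
  · rwa [integral_const_mul] at h
  have hd : ∀ j, fderiv ℝ (fun x : E3 => Real.cos (‖x‖ ^ 2 / (4 * t)) * u (t, x)
      + Real.sin (‖x‖ ^ 2 / (4 * t)) * w (t, x)) x (EuclideanSpace.single j 1)
      = Real.cos (‖x‖ ^ 2 / (4 * t)) * (dx j u (t, x) + x j * w (t, x) / (2 * t))
        + Real.sin (‖x‖ ^ 2 / (4 * t)) * (dx j w (t, x) - x j * u (t, x) / (2 * t)) := by
    intro j
    have hl := (hsm.differentiable one_ne_zero x).hasFDerivAt.hasLineDerivAt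
      (EuclideanSpace.single j 1)
    have hx : HasDerivAt (fun s : ℝ => x + s • EuclideanSpace.single j (1 : ℝ))
        (EuclideanSpace.single j 1) 0 := by
      simpa using ((hasDerivAt_id (0 : ℝ)).smul_const
        (EuclideanSpace.single j (1 : ℝ))).const_add x
    have hθ := (hx.norm_sq.div_const (4 * t))
    have hline : ∀ f, RapidDecay f → HasDerivAt
        (fun s : ℝ => f (t, x + s • EuclideanSpace.single j (1 : ℝ))) (dx j f (t, x)) 0 := by
      intro f hf
      have h := hf.hasDerivAt_line (coordDir j) (t, x)
      simp only [coordDir, Prod.smul_mk, Prod.mk_add_mk, smul_zero, add_zero] at h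
      exact h
    have hu1 := hline u hu
    have hw1 := hline w hw
    have hall := (hθ.cos.fun_mul hu1).fun_add (hθ.sin.fun_mul hw1)
    refine (hl.unique hall).trans ?_
    simp [PiLp.inner_apply]
    field_simp
    ring
  rw [pseudoDensity, Finset.mul_sum]
  refine (Finset.sum_le_sum fun j _ => ?_)
  rw [hd]
  set c := Real.cos (‖x‖ ^ 2 / (4 * t))
  set s := Real.sin (‖x‖ ^ 2 / (4 * t))
  have hcs : s ^ 2 + c ^ 2 = 1 := Real.sin_sq_add_cos_sq _
  set α := dx j u (t, x) + x j * w (t, x) / (2 * t) with hα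
  set β := dx j w (t, x) - x j * u (t, x) / (2 * t) with hβ
  have e : (4 * t ^ 2)⁻¹ * ((2 * t * dx j u (t, x) + x j * w (t, x)) ^ 2
      + (2 * t * dx j w (t, x) - x j * u (t, x)) ^ 2) = (s ^ 2 + c ^ 2) * (α ^ 2 + β ^ 2) := by
    rw [hcs, hα, hβ]
    field_simp
    ring
  rw [e]
  nlinarith [sq_nonneg (s * α - c * β)]

/-- Pseudoconformal Sobolev inequality: `‖φ‖₆ ≤ C ‖(x + 2it∇)φ‖₂ / t` for `φ = u + iw`. -/
lemma exists_integral_mass_cube_le : ∃ C : ℝ, 0 ≤ C ∧ ∀ (u w : ℝ × E3 → ℝ) (t : ℝ),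
    RapidDecay u → RapidDecay w → 0 < t →
    ∫ x, (u (t, x) * u (t, x) + w (t, x) * w (t, x)) ^ 3
      ≤ C * ((4 * t ^ 2)⁻¹ * ∫ x, pseudoDensity u w t x) ^ 3 := by
  obtain ⟨C, hC, hS⟩ := exists_integral_gauge_pow_six_le
  refine ⟨8 * C, by positivity, fun u w t hu hw ht => ?_⟩
  obtain ⟨i1, h1⟩ := hS u w t hu hw ht
  obtain ⟨i2, h2⟩ := hS w (fun p => -u p) t hw hu.neg ht
  simp only [pseudoDensity_rotate] at h2
  have hn : LocDecay fun p => u p * u p + w p * w p :=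
    (hu.locDecay.mul hu.locDecay).add (hw.locDecay.mul hw.locDecay)
  have hi : Integrable fun x => (u (t, x) * u (t, x) + w (t, x) * w (t, x)) ^ 3 :=
    ((hn.mul (hn.mul hn)).integrable t).congr (ae_of_all _ fun x => by simp only; ring)
  have h3 := integral_mono hi ((i1.add i2).const_mul 4) fun x => ?_
  · simp only [Pi.add_apply] at h3
    rw [integral_const_mul, integral_add i1 i2] at h3
    linarith
  · simp only [Pi.add_apply]
    set c := Real.cos (‖x‖ ^ 2 / (4 * t))
    set s := Real.sin (‖x‖ ^ 2 / (4 * t))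
    have hcs : s ^ 2 + c ^ 2 = 1 := Real.sin_sq_add_cos_sq _
    set a := c * u (t, x) + s * w (t, x) with ha
    set b := c * w (t, x) + s * -u (t, x) with hb
    have e : u (t, x) * u (t, x) + w (t, x) * w (t, x) = a ^ 2 + b ^ 2 := by
      rw [ha, hb]
      linear_combination -(u (t, x) ^ 2 + w (t, x) ^ 2) * hcs
    rw [e]
    nlinarith [mul_nonneg (add_nonneg (sq_nonneg a) (sq_nonneg b)) (sq_nonneg (a ^ 2 - b ^ 2))]

lemma IsCutoff.mul_deriv_nonpos {χ : ℝ → ℝ} (hχ : IsCutoff χ) {r : ℝ} (hr : 0 ≤ r) :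
    r * deriv χ r ≤ 0 := by
  rcases hr.eq_or_lt with rfl | hr
  · simp
  · refine mul_nonpos_of_nonneg_of_nonpos hr.le ?_
    rw [← derivWithin_of_mem_nhds (Ici_mem_nhds hr)]
    exact hχ.mono.derivWithin_nonpos

lemma integral_pseudoDensity {u w : ℝ × E3 → ℝ} (hu : RapidDecay u) (hw : RapidDecay w) (t : ℝ) :
    ∫ x, pseudoDensity u w t x
      = (∫ x : E3, ∑ i, x i * (x i * (u (t, x) * u (t, x) + w (t, x) * w (t, x))))
        - 4 * t * (∫ x : E3, ∑ i, x i * (u (t, x) * dx i w (t, x) - w (t, x) * dx i u (t, x)))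
        + 4 * t ^ 2 * ∫ x : E3, ∑ i, (dx i u (t, x) * dx i u (t, x)
          + dx i w (t, x) * dx i w (t, x)) := by
  have hux j := (hu.pd (coordDir j)).locDecay
  have hwx j := (hw.pd (coordDir j)).locDecay
  have i1 := (LocDecay.sum Finset.univ fun i _ => (((hu.locDecay.mul hu.locDecay).add
    (hw.locDecay.mul hw.locDecay)).coord_mul i).coord_mul i).integrable t
  have i2 := (LocDecay.sum Finset.univ fun i _ => ((hu.locDecay.mul (hwx i)).sub
    (hw.locDecay.mul (hux i))).coord_mul i).integrable t
  have i3 := (LocDecay.sum Finset.univ fun i _ => ((hux i).mul (hux i)).add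
    ((hwx i).mul (hwx i))).integrable t
  rw [← integral_const_mul, ← integral_const_mul, ← integral_sub i1 (i2.const_mul _),
    ← integral_add (i1.sub' (i2.const_mul _)) (i3.const_mul _)]
  refine integral_congr_ae (ae_of_all _ fun x => ?_)
  simp only [pseudoDensity, Fin.sum_univ_three]
  ring

/-- Growth bound for `‖(x + 2it∇)φ‖₂` from the pseudoconformal energy. -/
lemma SchrodingerPair.exists_integral_pseudoDensity_le {χ : ℝ → ℝ} (hχ : IsCutoff χ)
    {W u w : ℝ × E3 → ℝ} (h : SchrodingerPair W u w)
    (hW : ∀ g : ℝ × E3 → ℝ, LocDecay g → ∀ t, ∫ x, W (t, x) * g (t, x)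
      = ∫ z : E3 × E3, coulombKernel χ (z.1 - z.2) * g (t, z.1)
        * (u (t, z.2) * u (t, z.2) + w (t, z.2) * w (t, z.2))) :
    ∃ M : ℝ, ∀ t, 1 ≤ t → ∫ x, pseudoDensity u w t x ≤ M * t := by
  have hn : LocDecay fun p => u p * u p + w p * w p :=
    (h.re.locDecay.mul h.re.locDecay).add (h.im.locDecay.mul h.im.locDecay)
  have hn' : LocDecay fun p => 2 * (u p * dt u p + w p * dt w p) :=
    ((h.re.locDecay.mul (h.re.pd _).locDecay).add
      (h.im.locDecay.mul (h.im.pd _).locDecay)).const_mul 2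
  have hg : LocDecay fun p => 3 * (u p * u p + w p * w p)
      + ∑ i, p.2 i * (2 * (u p * dx i u p + w p * dx i w p)) :=
    (hn.const_mul 3).add (.sum _ fun i _ => (((h.re.locDecay.mul (h.re.pd _).locDecay).add
      (h.im.locDecay.mul (h.im.pd _).locDecay)).const_mul 2).coord_mul i)
  have hκ := integrable_coulombKernel hχ.smooth.continuous hχ.compact_supp
  have hκ' : Integrable (coulombKernel fun r => χ r - r * deriv χ r) :=
    integrable_coulombKernel (hχ.smooth.continuous.sub
      (continuous_id.mul (hχ.smooth.continuous_deriv (by simp))))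
      (hχ.compact_supp.sub hχ.compact_supp.deriv.mul_left)
  have hnt : ∀ t x, HasDerivAt (fun s => u (s, x) * u (s, x) + w (s, x) * w (s, x))
      (2 * (u (t, x) * dt u (t, x) + w (t, x) * dt w (t, x))) t := by
    intro t x
    have h1 := (h.re.decayDeriv timeDir).hasDerivAt_time t x
    have h2 := (h.im.decayDeriv timeDir).hasDerivAt_time t x
    refine ((h1.fun_mul h1).fun_add (h2.fun_mul h2)).congr_deriv ?_
    simp only [dt]
    ring
  set Q : ℝ → ℝ := fun t => ∫ z : E3 × E3, coulombKernel χ (z.1 - z.2)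
    * (u (t, z.1) * u (t, z.1) + w (t, z.1) * w (t, z.1))
    * (u (t, z.2) * u (t, z.2) + w (t, z.2) * w (t, z.2)) with hQ
  set Q' : ℝ → ℝ := fun t => ∫ z : E3 × E3, coulombKernel (fun r => χ r - r * deriv χ r) (z.1 - z.2)
    * (u (t, z.1) * u (t, z.1) + w (t, z.1) * w (t, z.1))
    * (u (t, z.2) * u (t, z.2) + w (t, z.2) * w (t, z.2)) with hQ'
  have hn0 : ∀ p, 0 ≤ u p * u p + w p * w p := fun p =>
    add_nonneg (mul_self_nonneg _) (mul_self_nonneg _)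
  have hQ0 : ∀ t, 0 ≤ Q t := fun t => integral_nonneg fun z =>
    mul_nonneg (mul_nonneg (mul_nonneg (inv_nonneg.2 (norm_nonneg _)) (hχ.nonneg _)) (hn0 _))
      (hn0 _)
  have hQQ' : ∀ t, Q t ≤ Q' t := fun t => by
    refine integral_mono (hn.integrable_kernel hκ hn t) (hn.integrable_kernel hκ' hn t) fun z => ?_
    have := hχ.mul_deriv_nonpos (norm_nonneg (z.1 - z.2))
    simp only [coulombKernel]
    gcongr
    · exact hn0 _
    · exact hn0 _
    · linarith
  set P : ℝ → ℝ := fun t => ∫ x, pseudoDensity u w t x with hP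
  have hP0 : ∀ t, 0 ≤ P t := fun t => integral_nonneg fun x => by
    simp only [pseudoDensity, Pi.zero_apply]
    positivity
  set F : ℝ → ℝ := fun t => P t + 2 * t ^ 2 * Q t with hF
  have hFd : ∀ t, HasDerivAt F (4 * t * Q t - 2 * t * Q' t) t := by
    intro t
    have hA := h.hasDerivAt_variance t
    have hB := h.hasDerivAt_dilation t
    have hD := h.hasDerivAt_kinetic t
    have hQd := hn.hasDerivAt_kernel hκ (coulombKernel_neg χ) hn' hnt t
    have hdil := integral_coulombKernel_dilation hχ.smooth hχ.compact_supp h.re h.im t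
    rw [hW _ hg t] at hB
    rw [hW _ hn' t] at hD
    have h4 : HasDerivAt (fun s : ℝ => 4 * s) 4 t := by
      simpa using (hasDerivAt_id t).const_mul 4
    have h2 (c : ℝ) : HasDerivAt (fun s : ℝ => c * s ^ 2) (c * (2 * t)) t := by
      simpa using (hasDerivAt_pow 2 t).const_mul c
    have hall := ((hA.fun_sub (h4.fun_mul hB)).fun_add ((h2 4).fun_mul hD)).fun_add
      ((h2 2).fun_mul hQd)
    have e : F = fun s => P s + 2 * s ^ 2 * Q s := rfl
    simp only [hP, integral_pseudoDensity h.re h.im] at e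
    rw [e]
    refine hall.congr_deriv ?_
    simp only [hQ, hQ']
    linear_combination (-2 * t) * hdil
  have hanti : AntitoneOn (fun t => F t / t) (Set.Ici 1) := by
    have hd : ∀ t, 1 ≤ t → HasDerivAt (fun t => F t / t)
        (((4 * t * Q t - 2 * t * Q' t) * t - F t * 1) / t ^ 2) t := fun t ht =>
      (hFd t).fun_div (hasDerivAt_id t) (by simp; linarith)
    refine antitoneOn_of_deriv_nonpos (convex_Ici 1)
      (fun t ht => (hd t ht).continuousAt.continuousWithinAt)
      (fun t ht => (hd t (interior_subset ht)).differentiableAt.differentiableWithinAt)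
      fun t ht => ?_
    rw [(hd t (interior_subset ht)).deriv]
    refine div_nonpos_of_nonpos_of_nonneg ?_ (sq_nonneg t)
    have := mul_nonneg (sq_nonneg t) (sub_nonneg.2 (hQQ' t))
    simp only [hF]
    nlinarith [hP0 t]
  refine ⟨F 1, fun t ht => ?_⟩
  have h1 := hanti Set.self_mem_Ici (Set.mem_Ici.2 ht) ht
  simp only [div_one] at h1
  rw [div_le_iff₀ (by linarith)] at h1
  refine le_trans ?_ h1
  simp only [hF]
  have := hQ0 t
  have : 0 ≤ 2 * t ^ 2 * Q t := by positivity
  linarith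

/-- Decay of the `L⁴` norm. -/
lemma SchrodingerPair.exists_integral_mass_sq_le {χ : ℝ → ℝ} (hχ : IsCutoff χ)
    {W u w : ℝ × E3 → ℝ} (h : SchrodingerPair W u w)
    (hW : ∀ g : ℝ × E3 → ℝ, LocDecay g → ∀ t, ∫ x, W (t, x) * g (t, x)
      = ∫ z : E3 × E3, coulombKernel χ (z.1 - z.2) * g (t, z.1)
        * (u (t, z.2) * u (t, z.2) + w (t, z.2) * w (t, z.2))) :
    ∃ C : ℝ, ∀ t, 1 ≤ t →
      ∫ x, (u (t, x) * u (t, x) + w (t, x) * w (t, x)) ^ 2 ≤ C * t ^ (-(3 : ℝ) / 2) := by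
  obtain ⟨M, hM⟩ := h.exists_integral_pseudoDensity_le hχ hW
  obtain ⟨S, hS0, hS⟩ := exists_integral_mass_cube_le
  set m : ℝ := ∫ x, (u (0, x) * u (0, x) + w (0, x) * w (0, x)) with hm
  have hmass : ∀ t, ∫ x, (u (t, x) * u (t, x) + w (t, x) * w (t, x)) = m := fun t =>
    is_const_of_deriv_eq_zero (fun t => (h.hasDerivAt_mass t).differentiableAt)
      (fun t => (h.hasDerivAt_mass t).deriv) t 0
  refine ⟨(m + S * (M / 4) ^ 3) / 2, fun t ht => ?_⟩
  have ht0 : 0 < t := by linarith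
  have hn : LocDecay fun p => u p * u p + w p * w p :=
    (h.re.locDecay.mul h.re.locDecay).add (h.im.locDecay.mul h.im.locDecay)
  have i2 : Integrable fun x => (u (t, x) * u (t, x) + w (t, x) * w (t, x)) ^ 2 :=
    ((hn.mul hn).integrable t).congr (ae_of_all _ fun x => by simp only; ring)
  have i3 : Integrable fun x => (u (t, x) * u (t, x) + w (t, x) * w (t, x)) ^ 3 :=
    ((hn.mul (hn.mul hn)).integrable t).congr (ae_of_all _ fun x => by simp only; ring)
  set e : ℝ := t ^ (-(3 : ℝ) / 2) with he
  have he0 : 0 < e := Real.rpow_pos_of_pos ht0 _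
  have hee : e ^ 2 = (t ^ 3)⁻¹ := by
    rw [he, ← Real.rpow_natCast, ← Real.rpow_mul ht0.le, ← Real.rpow_natCast, ← Real.rpow_neg ht0.le]
    norm_num
  have h3 : ∫ x, (u (t, x) * u (t, x) + w (t, x) * w (t, x)) ^ 3 ≤ S * (M / 4) ^ 3 * e ^ 2 := by
    have hP0 : 0 ≤ ∫ x, pseudoDensity u w t x := integral_nonneg fun x => by
      simp only [pseudoDensity, Pi.zero_apply]
      positivity
    calc _ ≤ S * ((4 * t ^ 2)⁻¹ * ∫ x, pseudoDensity u w t x) ^ 3 := hS u w t h.re h.im ht0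
      _ ≤ S * ((4 * t ^ 2)⁻¹ * (M * t)) ^ 3 := by gcongr; exact hM t ht
      _ = _ := by rw [hee]; field_simp
  have hle := integral_mono i2 (((hn.integrable t).const_mul (e / 2)).add (i3.const_mul (e⁻¹ / 2)))
    fun x => ?_
  · simp only [Pi.add_apply] at hle
    rw [integral_add ((hn.integrable t).const_mul _) (i3.const_mul _), integral_const_mul,
      integral_const_mul, hmass] at hle
    refine hle.trans ?_
    calc _ ≤ e / 2 * m + e⁻¹ / 2 * (S * (M / 4) ^ 3 * e ^ 2) := by gcongr
      _ = _ := by field_simp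
  · simp only [Pi.add_apply]
    set n := u (t, x) * u (t, x) + w (t, x) * w (t, x) with hnn
    have hn0 : 0 ≤ n := add_nonneg (mul_self_nonneg _) (mul_self_nonneg _)
    have e1 : e / 2 * n + e⁻¹ / 2 * n ^ 3 - n ^ 2 = n * (e - n) ^ 2 / (2 * e) := by
      field_simp
      ring
    have : 0 ≤ n * (e - n) ^ 2 / (2 * e) := by positivity
    linarith

lemma pd_clm_comp {Ψ : ℝ × E3 → ℂ} (hΨ : Differentiable ℝ Ψ) (L : ℂ →L[ℝ] ℝ) (a p : ℝ × E3) :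
    pd a (fun p => L (Ψ p)) p = L (fderiv ℝ Ψ p a) := by
  have h : HasFDerivAt (fun p => L (Ψ p)) (L.comp (fderiv ℝ Ψ p)) p :=
    L.hasFDerivAt.comp p (hΨ p).hasFDerivAt
  rw [pd, h.fderiv]
  rfl

lemma fderiv_slice {Ψ : ℝ × E3 → ℂ} (hΨ : Differentiable ℝ Ψ) (t : ℝ) (x : E3) (j : Fin 3) :
    fderiv ℝ (fun y => Ψ (t, y)) x (EuclideanSpace.single j 1) = fderiv ℝ Ψ (t, x) (coordDir j) := by
  have h : HasFDerivAt (fun y => Ψ (t, y)) ((fderiv ℝ Ψ (t, x)).comp (.inr ℝ ℝ E3)) x :=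
    (hΨ (t, x)).hasFDerivAt.comp x (hasFDerivAt_prodMk_right t x)
  rw [h.fderiv]
  simp [coordDir]

lemma deriv_slice {Ψ : ℝ × E3 → ℂ} (hΨ : Differentiable ℝ Ψ) (t : ℝ) (x : E3) :
    deriv (fun s => Ψ (s, x)) t = fderiv ℝ Ψ (t, x) timeDir :=
  ((hΨ (t, x)).hasFDerivAt.comp_hasDerivAt t
    ((hasDerivAt_id t).prodMk (hasDerivAt_const t x))).deriv

/-- The real and imaginary parts of a Hartree solution. -/
lemma IsHartreeSolution.schrodingerPair {v : E3 → ℝ} {φ : ℝ → E3 → ℂ} (h : IsHartreeSolution v φ) :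
    SchrodingerPair (fun p => hartreeW v (φ p.1) p.2) (fun p => (φ p.1 p.2).re)
      (fun p => (φ p.1 p.2).im) := by
  set Φ : ℝ × E3 → ℂ := fun p => φ p.1 p.2 with hΦ_def
  have hΦ : Differentiable ℝ Φ := h.smooth.differentiable (by simp)
  have hΦ' : ∀ j, Differentiable ℝ fun p => fderiv ℝ Φ p (coordDir j) := fun j =>
    ((h.smooth.fderiv_right (m := (⊤ : ℕ∞)) (by simp)).clm_apply contDiff_const).differentiable
      (by simp)
  have hdt (L : ℂ →L[ℝ] ℝ) (p : ℝ × E3) :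
      dt (fun p => L (Φ p)) p = L (deriv (fun s => φ s p.2) p.1) := by
    rw [dt, pd_clm_comp hΦ, ← deriv_slice hΦ]
  have hlap (L : ℂ →L[ℝ] ℝ) (p : ℝ × E3) :
      ∑ j, dx j (dx j fun p => L (Φ p)) p = L (lapC (φ p.1) p.2) := by
    rw [lapC, map_sum]
    refine Finset.sum_congr rfl fun j _ => ?_
    have e1 : (dx j fun p => L (Φ p)) = fun p => L (fderiv ℝ Φ p (coordDir j)) :=
      funext fun p => pd_clm_comp hΦ L _ p
    have e2 : (fun y => fderiv ℝ (φ p.1) y (EuclideanSpace.single j 1))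
        = fun y => fderiv ℝ Φ (p.1, y) (coordDir j) := funext fun y => fderiv_slice hΦ p.1 y j
    rw [e1, e2, dx, pd_clm_comp (hΦ' j), ← fderiv_slice (hΦ' j)]
  refine ⟨.of_clm h Complex.reCLM, .of_clm h Complex.imCLM, fun p => ?_, fun p => ?_⟩
  · have e := congrArg Complex.im (h.eqn p.1 p.2)
    have e1 := hdt Complex.reCLM p
    have e2 := hlap Complex.imCLM p
    simp only [Complex.reCLM_apply, Complex.imCLM_apply, hΦ_def] at e1 e2
    rw [e1, e2]
    simp at e
    linear_combination e
  · have e := congrArg Complex.re (h.eqn p.1 p.2)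
    have e1 := hdt Complex.imCLM p
    have e2 := hlap Complex.reCLM p
    simp only [Complex.reCLM_apply, Complex.imCLM_apply, hΦ_def] at e1 e2
    rw [e1, e2]
    simp at e
    linear_combination -e

lemma hartreeW_congr_ae {v κ : E3 → ℝ} (h : v =ᵐ[volume] κ) (f : E3 → ℂ) :
    hartreeW v f = hartreeW κ f :=
  funext fun x => integral_congr_ae (h.mono fun y hy => by simp only [hy])

lemma coulomb_remainder_kernel {χ : ℝ → ℝ} (hχ : Differentiable ℝ χ) {r : ℝ} (hr : 0 ≤ r) :
    -4 * (χ r / r) - 2 * r * deriv (fun r => χ r / r) r = r⁻¹ * (-2 * (χ r + r * deriv χ r)) := by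
  rcases hr.eq_or_lt with rfl | hr
  · simp
  · rw [((hχ r).hasDerivAt.fun_div (hasDerivAt_id' r) hr.ne').deriv]
    field_simp
    ring

/-- Decay of the pseudoconformal remainder: there is `C` (depending on `φ` and `v`)
such that `|R_c(t)| ≤ C t^{−1/2}` for all `t ≥ 1`, where `R_c` is defined with
`V(r) = χ(r)/r`. -/
theorem pseudoconformal_remainder_decay (v : E3 → ℝ) (χ : ℝ → ℝ) (hχ : IsCutoff χ)
    (hv : ∀ x : E3, x ≠ 0 → v x = χ ‖x‖ / ‖x‖)
    (φ : ℝ → E3 → ℂ) (hφ : IsHartreeSolution v φ) :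
    ∃ C : ℝ, ∀ t : ℝ, 1 ≤ t → |RcH (fun r => χ r / r) φ t| ≤ C * t ^ (-(1:ℝ)/2) := by
  have hp := hφ.schrodingerPair
  have hnorm : ∀ t x, ‖φ t x‖ ^ 2 = (φ t x).re * (φ t x).re + (φ t x).im * (φ t x).im :=
    fun t x => by rw [Complex.sq_norm, Complex.normSq_apply]
  have hn : LocDecay fun p => (φ p.1 p.2).re * (φ p.1 p.2).re + (φ p.1 p.2).im * (φ p.1 p.2).im :=
    (hp.re.locDecay.mul hp.re.locDecay).add (hp.im.locDecay.mul hp.im.locDecay)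
  have hvκ : v =ᵐ[volume] coulombKernel χ := by
    filter_upwards [compl_mem_ae_iff.2 (measure_singleton (0 : E3))] with x hx
    rw [hv x hx, coulombKernel, div_eq_inv_mul]
  obtain ⟨C, hC⟩ := hp.exists_integral_mass_sq_le hχ fun g hg t => by
    have h := integral_hartreeW_mul (φ := φ) (integrable_coulombKernel hχ.smooth.continuous
      hχ.compact_supp) (by simpa only [hnorm] using hn) hg t
    simpa only [hartreeW_congr_ae hvκ, hnorm] using h
  set η : ℝ → ℝ := fun r => -2 * (χ r + r * deriv χ r) with hη
  have hκ : Integrable (coulombKernel η) := integrable_coulombKernel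
    (continuous_const.mul (hχ.smooth.continuous.add
      (continuous_id.mul (hχ.smooth.continuous_deriv (by simp)))))
    (hχ.compact_supp.add hχ.compact_supp.deriv.mul_left).mul_left
  refine ⟨(∫ x, |coulombKernel η x|) * ((1 / 4) * C), fun t ht => ?_⟩
  have ht0 : 0 < t := by linarith
  have hρ : LocDecay fun p => rhoH φ p.1 p.2 := by
    simpa only [rhoH, hnorm] using hn.const_mul (1 / 2)
  have hR : RcH (fun r => χ r / r) φ t = t * ∫ z : E3 × E3,
      coulombKernel η (z.1 - z.2) * rhoH φ t z.1 * rhoH φ t z.2 := by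
    have hi := hρ.integrable_kernel hκ hρ t
    rw [Measure.volume_eq_prod] at hi ⊢
    rw [integral_prod _ hi, RcH]
    simp only [coulomb_remainder_kernel (hχ.smooth.differentiable (by simp)) (norm_nonneg _),
      coulombKernel, hη]
  have hsq : ∫ x, rhoH φ t x ^ 2 ≤ (1 / 4) * (C * t ^ (-(3 : ℝ) / 2)) := by
    refine le_trans (le_of_eq ?_) (mul_le_mul_of_nonneg_left (hC t ht) (by norm_num))
    rw [← integral_const_mul]
    refine integral_congr_ae (ae_of_all _ fun x => ?_)
    simp only [rhoH, hnorm]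
    ring
  have hpow : t * t ^ (-(3 : ℝ) / 2) = t ^ (-(1 : ℝ) / 2) := by
    rw [← Real.rpow_one_add' ht0.le (by norm_num)]
    norm_num
  rw [hR, abs_mul, abs_of_pos ht0, ← hpow]
  have hK := abs_integral_kernel_le hκ (a := rhoH φ t)
    (((hρ.mul hρ).integrable t).congr (ae_of_all _ fun x => by simp only; ring))
  calc _ ≤ t * ((∫ x, |coulombKernel η x|) * ((1 / 4) * (C * t ^ (-(3 : ℝ) / 2)))) := by
        refine mul_le_mul_of_nonneg_left (hK.trans ?_) ht0.le
        exact mul_le_mul_of_nonneg_left hsq (integral_nonneg fun x => abs_nonneg _)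
    _ = _ := by ring
end
end

section
/- Equivalence of the two conservation-type operator identities (Lemma of Section 3): let H be a complex Hilbert space and c : H → H a conjugation (a conjugate-linear isometric involution); for a bounded operator A write Ā := c ∘ A ∘ c. Let g, u, m : ℝ → B(H) be families of bounded operators and p : ℝ → B(H) a family differentiable in operator norm, with each p(t) self-adjoint and nonnegative (so that 1 + p(t) has a bounded inverse r(t)). Set q := 2p + p², and for a differentiable family a define W(a)(t) := i a′(t) + g(t) a(t) − a(t) g(t). Then for each t the following two identities are equivalent: (i) ( W(p)(t) + u(t) m̄(t) ) r(t) + r(t) ( W(p)(t) − m(t) ū(t) ) = 0; (ii) W(q)(t) = m(t) ū(t) (1 + p(t)) − (1 + p(t)) u(t) m̄(t). Here juxtaposition denotes composition of operators. -/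
open ContinuousLinearMap

/-- If `r` is a two-sided inverse of `P`, then multiplying by `P` on both sides clears `r`
from the equation `a r + r b = 0`. -/
theorem mul_inv_add_inv_mul_eq_zero_iff {R : Type*} [Ring R] {P r : R}
    (h₁ : P * r = 1) (h₂ : r * P = 1) (a b : R) :
    a * r + r * b = 0 ↔ P * a + b * P = 0 := by
  have key : P * (a * r + r * b) * P = P * a + b * P := by
    calc P * (a * r + r * b) * P = P * a * (r * P) + (P * r) * b * P := by noncomm_ring
      _ = P * a + b * P := by rw [h₁, h₂, mul_one, one_mul]
  have key' : r * (P * a + b * P) * r = a * r + r * b := by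
    calc r * (P * a + b * P) * r = (r * P) * a * r + r * b * (P * r) := by noncomm_ring
      _ = a * r + r * b := by rw [h₁, h₂, mul_one, one_mul]
  constructor <;> intro h
  · rw [← key, h, mul_zero, zero_mul]
  · rw [← key', h, mul_zero, zero_mul]

/-- Equivalence of the two conservation-type operator identities: with
`Ā := c ∘ A ∘ c` for a conjugation `c`, `q = 2p + p²`, `r = (1+p)⁻¹`, and
`W(a) = i a′ + [g, a]`, the identities
`(W(p) + u m̄) r + r (W(p) − m ū) = 0` and
`W(q) = m ū (1+p) − (1+p) u m̄`
are equivalent at each time `t`. -/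
theorem conservation_identities_equiv
    {H : Type*} [NormedAddCommGroup H] [InnerProductSpace ℂ H] [CompleteSpace H]
    (c : H → H)
    (hc_add : ∀ x y : H, c (x + y) = c x + c y)
    (hc_smul : ∀ (a : ℂ) (x : H), c (a • x) = (starRingEnd ℂ a) • c x)
    (hc_invol : ∀ x : H, c (c x) = x)
    (hc_norm : ∀ x : H, ‖c x‖ = ‖x‖)
    (conjOp : (H →L[ℂ] H) → (H →L[ℂ] H))
    (hconjOp : ∀ (A : H →L[ℂ] H) (x : H), conjOp A x = c (A (c x)))
    (g u m p p' r : ℝ → H →L[ℂ] H)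
    (hp' : ∀ t, HasDerivAt p (p' t) t)
    (hp_pos : ∀ t, (p t).IsPositive)
    (hr₁ : ∀ t, (1 + p t) * r t = 1)
    (hr₂ : ∀ t, r t * (1 + p t) = 1)
    (t : ℝ) :
    ((Complex.I • p' t + g t * p t - p t * g t + u t * conjOp (m t)) * r t
        + r t * (Complex.I • p' t + g t * p t - p t * g t - m t * conjOp (u t)) = 0)
    ↔
    (Complex.I • ((2:ℂ) • p' t + p' t * p t + p t * p' t)
        + g t * ((2:ℂ) • p t + p t * p t) - ((2:ℂ) • p t + p t * p t) * g t
      = m t * conjOp (u t) * (1 + p t) - (1 + p t) * (u t * conjOp (m t))) := by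
  rw [mul_inv_add_inv_mul_eq_zero_iff (hr₁ t) (hr₂ t), ← sub_eq_zero (b := _ - _)]
  refine Eq.congr_left ?_
  simp only [smul_add, two_smul, mul_add, add_mul, mul_sub, sub_mul, one_mul, mul_one,
    smul_mul_assoc, mul_smul_comm, mul_assoc]
  abel
end

section
/- Gronwall-type a priori estimate (core of the a priori Theorem): let T ≥ 0, let M : [0,T] → ℝ be continuous and nonnegative, and let f : [0,T] → ℝ be continuous and nonnegative such that t ↦ f(t)² is differentiable on [0,T] and satisfies (f²)′(t) ≤ 2 M(t) f(t) + 2 M(t) f(t)² for all t ∈ [0,T]. Then f(T) ≤ ( ∫_0^T M(s) ds + f(0) ) · exp( ∫_0^T M(s) ds ). -/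
open Set Real in
/-- Exponential comparison: if `g' ≤ M (g + 1)` on `(0, T)` then
`g(T) + 1 ≤ (g(0) + 1) exp(∫₀ᵀ M)`. -/
theorem add_one_le_mul_exp_integral_of_deriv_le {T : ℝ} (hT : 0 ≤ T) {M g g' : ℝ → ℝ}
    (hM : ContinuousOn M (Icc 0 T)) (hg : ContinuousOn g (Icc 0 T))
    (hderiv : ∀ t ∈ Ioo 0 T, HasDerivAt g (g' t) t)
    (hle : ∀ t ∈ Ioo 0 T, g' t ≤ M t * (g t + 1)) :
    g T + 1 ≤ (g 0 + 1) * exp (∫ s in (0:ℝ)..T, M s) := by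
  set A : ℝ → ℝ := fun t => ∫ s in (0:ℝ)..t, M s with hA
  have hA_cont : ContinuousOn A (Icc 0 T) := by
    have := intervalIntegral.continuousOn_primitive_interval (μ := MeasureTheory.volume)
      (f := M) (a := 0) (b := T) (by rw [uIcc_of_le hT]; exact hM.integrableOn_Icc)
    rwa [uIcc_of_le hT] at this
  have hA_deriv : ∀ t ∈ Ioo 0 T, HasDerivAt A (M t) t := fun t ht =>
    intervalIntegral.integral_hasDerivAt_right
      ((hM.mono (Icc_subset_Icc_right ht.2.le)).intervalIntegrable_of_Icc ht.1.le)
      ((hM.mono Ioo_subset_Icc_self).stronglyMeasurableAtFilter isOpen_Ioo t ht)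
      (hM.continuousAt (Icc_mem_nhds ht.1 ht.2))
  have hanti : AntitoneOn (fun t => (g t + 1) * exp (-A t)) (Icc 0 T) := by
    refine antitoneOn_of_hasDerivWithinAt_nonpos (convex_Icc 0 T)
      (f' := fun t => g' t * exp (-A t) + (g t + 1) * (exp (-A t) * -M t))
      ((hg.add continuousOn_const).mul hA_cont.neg.rexp) ?_ ?_
    · rw [interior_Icc]
      exact fun t ht =>
        (((hderiv t ht).add_const 1).mul (hA_deriv t ht).neg.exp).hasDerivWithinAt
    · rw [interior_Icc]
      intro t ht
      have := mul_le_mul_of_nonneg_right (hle t ht) (exp_pos (-A t)).le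
      linarith
  have h := hanti (left_mem_Icc.2 hT) (right_mem_Icc.2 hT) hT
  have hA0 : A 0 = 0 := intervalIntegral.integral_same
  simp only [hA0, neg_zero, exp_zero, mul_one] at h
  rwa [exp_neg, ← div_eq_mul_inv, div_le_iff₀ (exp_pos _)] at h

/-- Gronwall-type a priori estimate: if `f, M ≥ 0` are continuous on `[0,T]`, `f²` is
differentiable with `(f²)′(t) ≤ 2 M(t) f(t) + 2 M(t) f(t)²` on `[0,T]`, then
`f(T) ≤ (∫₀ᵀ M + f(0)) exp(∫₀ᵀ M)`. -/
theorem gronwall_apriori (T : ℝ) (hT : 0 ≤ T) (M f d : ℝ → ℝ)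
    (hM : ContinuousOn M (Set.Icc 0 T))
    (hM_nonneg : ∀ t ∈ Set.Icc 0 T, 0 ≤ M t)
    (hf : ContinuousOn f (Set.Icc 0 T))
    (hf_nonneg : ∀ t ∈ Set.Icc 0 T, 0 ≤ f t)
    (hderiv : ∀ t ∈ Set.Icc 0 T, HasDerivAt (fun s => f s ^ 2) (d t) t)
    (hd : ∀ t ∈ Set.Icc 0 T, d t ≤ 2 * M t * f t + 2 * M t * f t ^ 2) :
    f T ≤ ((∫ s in (0:ℝ)..T, M s) + f 0) * Real.exp (∫ s in (0:ℝ)..T, M s) := by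
  have key : ∀ ε > 0, f T + 1 ≤ (f 0 + ε + 1) * Real.exp (∫ s in (0:ℝ)..T, M s) := by
    intro ε hε
    have hpos : ∀ t, 0 < f t ^ 2 + ε ^ 2 := fun t => by positivity
    have h := add_one_le_mul_exp_integral_of_deriv_le hT hM
      (g := fun t => √(f t ^ 2 + ε ^ 2)) (g' := fun t => d t / (2 * √(f t ^ 2 + ε ^ 2)))
      ((hf.pow 2).add continuousOn_const).sqrt
      (fun t ht => ((hderiv t (Set.Ioo_subset_Icc_self ht)).add_const _).sqrt (hpos t).ne')
      (fun t ht => by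
        have ht' := Set.Ioo_subset_Icc_self ht
        have hg := Real.sqrt_pos.2 (hpos t)
        have hfg : f t ≤ √(f t ^ 2 + ε ^ 2) := Real.le_sqrt_of_sq_le (by nlinarith)
        rw [div_le_iff₀ (by positivity)]
        calc d t ≤ 2 * (M t * (f t + 1)) * f t := by linarith [hd t ht']
          _ ≤ 2 * (M t * (√(f t ^ 2 + ε ^ 2) + 1)) * √(f t ^ 2 + ε ^ 2) := by
            have := hM_nonneg t ht'
            have := hf_nonneg t ht'
            gcongr
          _ = _ := by ring)
    have hfT : f T ≤ √(f T ^ 2 + ε ^ 2) := Real.le_sqrt_of_sq_le (by nlinarith)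
    have hf0 : √(f 0 ^ 2 + ε ^ 2) ≤ f 0 + ε := by
      have := hf_nonneg 0 (Set.left_mem_Icc.2 hT)
      exact Real.sqrt_le_iff.2 ⟨by positivity, by nlinarith⟩
    calc f T + 1 ≤ √(f T ^ 2 + ε ^ 2) + 1 := by gcongr
      _ ≤ (√(f 0 ^ 2 + ε ^ 2) + 1) * Real.exp (∫ s in (0:ℝ)..T, M s) := h
      _ ≤ _ := by gcongr
  set A := ∫ s in (0:ℝ)..T, M s
  have hlim : f T + 1 ≤ (f 0 + 1) * Real.exp A := by
    refine le_of_forall_pos_le_add fun δ hδ => ?_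
    have h := key (δ / Real.exp A) (by positivity)
    have hcancel : δ / Real.exp A * Real.exp A = δ := div_mul_cancel₀ _ (Real.exp_pos A).ne'
    linarith
  have hexp : (1 - A) * Real.exp A ≤ 1 := by
    calc (1 - A) * Real.exp A ≤ Real.exp (-A) * Real.exp A := by
          gcongr
          exact Real.one_sub_le_exp_neg A
      _ = 1 := by rw [← Real.exp_add, neg_add_cancel, Real.exp_zero]
  linarith
end

section
/- Characterization of the Lie algebra elements generating positive symplectic matrices: let m be a finite type, work in the square matrices over ℂ indexed by m ⊕ m, and set J := fromBlocks 0 (−1) 1 0 and L := fromBlocks 1 0 0 (−1). Suppose p is Hermitian (pᴴ = p), satisfies pᵀ · J + J · p = 0, and satisfies L · p · L = −p. Then there exists an m×m complex matrix k with kᵀ = k such that p = fromBlocks 0 k k̄ 0, where k̄ is the entrywise complex conjugate of k. -/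
open Matrix

noncomputable section

variable (m : Type*) [Fintype m] [DecidableEq m]

/-- The standard symplectic matrix `J = fromBlocks 0 (−1) 1 0`. -/
def Jmat : Matrix (m ⊕ m) (m ⊕ m) ℂ := fromBlocks 0 (-1) 1 0

/-- The change-of-basis matrix `C = (√2)⁻¹ • fromBlocks 1 (−i•1) 1 (i•1)`. -/
def Cmat : Matrix (m ⊕ m) (m ⊕ m) ℂ :=
  ((Real.sqrt 2 : ℂ))⁻¹ • fromBlocks 1 ((-Complex.I) • 1) 1 (Complex.I • 1)

/-- Entrywise complex conjugate of a complex matrix. -/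
def conjMat {n l : Type*} (A : Matrix n l ℂ) : Matrix n l ℂ := A.map (starRingEnd ℂ)

/-- The reflection matrix `L = fromBlocks 1 0 0 (−1)`. -/
def Lmat : Matrix (m ⊕ m) (m ⊕ m) ℂ := fromBlocks 1 0 0 (-1)

/-- Characterization of Lie algebra elements generating positive symplectic matrices:
a Hermitian `p` with `pᵀ J + J p = 0` and `L p L = −p` has the form
`p = fromBlocks 0 k k̄ 0` for a symmetric matrix `k`. -/
theorem generator_characterization (m : Type*) [Fintype m] [DecidableEq m]
    (p : Matrix (m ⊕ m) (m ⊕ m) ℂ) (hp : pᴴ = p)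
    (hsymp : pᵀ * Jmat m + Jmat m * p = 0)
    (hrefl : Lmat m * p * Lmat m = -p) :
    ∃ k : Matrix m m ℂ, kᵀ = k ∧ p = fromBlocks 0 k (conjMat k) 0 := by
  obtain ⟨a, b, c, d, rfl⟩ : ∃ a b c d, p = fromBlocks a b c d :=
    ⟨_, _, _, _, (fromBlocks_toBlocks p).symm⟩
  simp only [Lmat, fromBlocks_multiply, fromBlocks_neg, fromBlocks_inj, one_mul, zero_mul,
    mul_one, mul_zero, neg_mul, mul_neg, neg_neg, add_zero, zero_add] at hrefl
  obtain ⟨ha, -, -, hd⟩ := hrefl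
  obtain rfl : a = 0 := by
    ext i j
    exact self_eq_neg.mp (congr_fun₂ ha i j)
  obtain rfl : d = 0 := by
    ext i j
    exact self_eq_neg.mp (congr_fun₂ hd i j)
  simp only [Jmat, fromBlocks_transpose, fromBlocks_multiply, fromBlocks_add,
    ← fromBlocks_zero, fromBlocks_inj, one_mul, zero_mul, mul_one, mul_zero, neg_mul, mul_neg,
    add_zero, zero_add, transpose_zero, neg_zero] at hsymp
  have hb : bᵀ = b := neg_add_eq_zero.mp hsymp.2.2.2
  rw [fromBlocks_conjTranspose, fromBlocks_inj] at hp
  refine ⟨b, hb, ?_⟩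
  have hc : conjMat b = c := by
    rw [← hp.2.2.1]
    nth_rw 1 [← hb]
    rfl
  rw [hc]
end
end
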